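/- arXiv:1510.03240 — 5 statements merged into one kernel-verified Lean document; each statement's English description precedes it below -/
import Mathlib

section
/- Let d ≥ 2 and let Δ be a traceless Hermitian matrix on C^d ⊗ C^d such that Δ is not of the form I ⊗ Ξ for any traceless Hermitian d×d matrix Ξ. Then there exist a classical-quantum state ρ on C^d ⊗ C^d and a real number λ such that ρ + λΔ is a state but is not classical-quantum. Moreover, ρ can be taken to be classical-classical. -/
open Matrix
open Kronecker
open scoped ComplexOrder

noncomputable section

/-- A state (density matrix): positive semidefinite with trace 1. -/
def IsState {n : Type*} [Fintype n] (ρ : Matrix n n ℂ) : Prop :=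
  ρ.PosSemidef ∧ ρ.trace = 1

/-- A family of `d` vectors in `ℂ^d` forming an orthonormal basis. -/
def IsONB {d : ℕ} (φ : Fin d → Fin d → ℂ) : Prop :=
  ∀ i j, star (φ i) ⬝ᵥ φ j = if i = j then 1 else 0

/-- Classical-quantum states: `ρ = ∑ᵢ cᵢ |φᵢ⟩⟨φᵢ| ⊗ ηᵢ` for an orthonormal basis `{φᵢ}`,
nonnegative `cᵢ` summing to `1`, and states `ηᵢ`. -/
def IsCQ {d : ℕ} (ρ : Matrix (Fin d × Fin d) (Fin d × Fin d) ℂ) : Prop :=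
  ∃ (φ : Fin d → Fin d → ℂ) (c : Fin d → ℝ) (η : Fin d → Matrix (Fin d) (Fin d) ℂ),
    IsONB φ ∧ (∀ i, 0 ≤ c i) ∧ ((∑ i, c i) = 1) ∧ (∀ i, IsState (η i)) ∧
    ρ = ∑ i, (c i : ℂ) • (vecMulVec (φ i) (star (φ i)) ⊗ₖ η i)

/-- Quantum-classical states: `ρ = ∑ᵢ cᵢ σᵢ ⊗ |χᵢ⟩⟨χᵢ|`. -/
def IsQC {d : ℕ} (ρ : Matrix (Fin d × Fin d) (Fin d × Fin d) ℂ) : Prop :=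
  ∃ (χ : Fin d → Fin d → ℂ) (c : Fin d → ℝ) (σ : Fin d → Matrix (Fin d) (Fin d) ℂ),
    IsONB χ ∧ (∀ i, 0 ≤ c i) ∧ ((∑ i, c i) = 1) ∧ (∀ i, IsState (σ i)) ∧
    ρ = ∑ i, (c i : ℂ) • (σ i ⊗ₖ vecMulVec (χ i) (star (χ i)))

/-- Classical-classical states: `ρ = ∑ᵢⱼ cᵢⱼ |φᵢ⟩⟨φᵢ| ⊗ |χⱼ⟩⟨χⱼ|`. -/
def IsCC {d : ℕ} (ρ : Matrix (Fin d × Fin d) (Fin d × Fin d) ℂ) : Prop :=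
  ∃ (φ χ : Fin d → Fin d → ℂ) (c : Fin d → Fin d → ℝ),
    IsONB φ ∧ IsONB χ ∧ (∀ i j, 0 ≤ c i j) ∧ ((∑ i, ∑ j, c i j) = 1) ∧
    ρ = ∑ i, ∑ j, (c i j : ℂ) • (vecMulVec (φ i) (star (φ i)) ⊗ₖ vecMulVec (χ j) (star (χ j)))

theorem isONB_single (d : ℕ) : IsONB fun j : Fin d => (Pi.single j 1 : Fin d → ℂ) := by
  intro i j
  simp [Pi.star_single, Pi.single_apply, eq_comm]

theorem IsONB.sum_vecMulVec {d : ℕ} {φ : Fin d → Fin d → ℂ} (hφ : IsONB φ) :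
    ∑ i, vecMulVec (φ i) (star (φ i)) = 1 := by
  have h : (of φ)ᵀᴴ * (of φ)ᵀ = 1 := by
    ext i j
    simpa [mul_apply, one_apply, dotProduct] using hφ i j
  rw [← mul_eq_one_comm.mp h]
  ext i j
  simp [mul_apply, Matrix.sum_apply, vecMulVec_apply]

theorem Matrix.IsHermitian.exists_isONB_eq_sum {d : ℕ} {H : Matrix (Fin d) (Fin d) ℂ}
    (hH : H.IsHermitian) :
    ∃ φ : Fin d → Fin d → ℂ, IsONB φ ∧
      H = ∑ i, (hH.eigenvalues i : ℂ) • vecMulVec (φ i) (star (φ i)) := by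
  refine ⟨fun i j => (hH.eigenvectorUnitary : Matrix (Fin d) (Fin d) ℂ) j i, fun i j => ?_, ?_⟩
  · have h := congrFun₂ (Unitary.coe_star_mul_self hH.eigenvectorUnitary) i j
    simpa only [mul_apply, one_apply, dotProduct, star_apply, Pi.star_apply] using h
  · conv_lhs => rw [hH.spectral_theorem, Unitary.conjStarAlgAut_apply]
    ext i j
    simp only [mul_apply, diagonal_apply, sum_apply, smul_apply, vecMulVec_apply, star_apply,
      Pi.star_apply, smul_eq_mul, mul_ite, mul_zero, Finset.sum_ite_eq', Finset.mem_univ, if_true,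
      Function.comp_apply]
    refine Finset.sum_congr rfl fun l _ => ?_
    simp
    ring

theorem trace_vecMulVec_self_star {d : ℕ} {φ : Fin d → Fin d → ℂ} (hφ : IsONB φ) (i : Fin d) :
    (vecMulVec (φ i) (star (φ i))).trace = 1 := by
  rw [trace_vecMulVec, dotProduct_comm, hφ i i, if_pos rfl]

theorem IsCC.trace_eq_one {d : ℕ} {ρ : Matrix (Fin d × Fin d) (Fin d × Fin d) ℂ} (h : IsCC ρ) :
    ρ.trace = 1 := by
  obtain ⟨φ, χ, c, hφ, hχ, -, hc, rfl⟩ := h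
  simp only [trace_sum, trace_smul, trace_kronecker, trace_vecMulVec_self_star hφ,
    trace_vecMulVec_self_star hχ, mul_one, smul_eq_mul]
  exact_mod_cast hc

theorem IsCC.isCQ {d : ℕ} {ρ : Matrix (Fin d × Fin d) (Fin d × Fin d) ℂ} (h : IsCC ρ) :
    IsCQ ρ := by
  obtain ⟨φ, χ, c, hφ, hχ, hc0, hc, rfl⟩ := h
  have hψ (j : Fin d) : IsState (vecMulVec (χ j) (star (χ j))) :=
    ⟨posSemidef_vecMulVec_self_star _, trace_vecMulVec_self_star hχ j⟩
  have key (i : Fin d) : ∃ η : Matrix (Fin d) (Fin d) ℂ, IsState η ∧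
      ∑ j, (c i j : ℂ) • vecMulVec (χ j) (star (χ j)) = ((∑ j, c i j : ℝ) : ℂ) • η := by
    rcases (Finset.sum_nonneg fun j (_ : j ∈ Finset.univ) => hc0 i j).eq_or_lt with h0 | h0
    · refine ⟨_, hψ i, ?_⟩
      rw [← h0]
      have hz := (Finset.sum_eq_zero_iff_of_nonneg fun j _ => hc0 i j).mp h0.symm
      simp [fun j => hz j (Finset.mem_univ j)]
    · have hne : ((∑ j, c i j : ℝ) : ℂ) ≠ 0 := by exact_mod_cast h0.ne'
      refine ⟨((∑ j, c i j : ℝ) : ℂ)⁻¹ • ∑ j, (c i j : ℂ) • vecMulVec (χ j) (star (χ j)),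
        ⟨?_, ?_⟩, ?_⟩
      · refine PosSemidef.smul (posSemidef_sum _ fun j _ => (hψ j).1.smul ?_) ?_
        · exact_mod_cast hc0 i j
        · exact_mod_cast (inv_pos.mpr h0).le
      · simp only [trace_smul, trace_sum, (hψ _).2, smul_eq_mul, mul_one]
        rw [← Complex.ofReal_sum, inv_mul_cancel₀ hne]
      · rw [smul_inv_smul₀ hne]
  choose η hη hsum using key
  refine ⟨φ, fun i => ∑ j, c i j, η, hφ, fun i => Finset.sum_nonneg fun j _ => hc0 i j, hc, hη,
    Finset.sum_congr rfl fun i _ => ?_⟩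
  rw [← kronecker_smul, ← hsum i]
  ext a b
  simp [Matrix.sum_apply, Finset.mul_sum, mul_left_comm]

/-- The block of a bipartite operator at position `(k, l)` of the second factor. -/
def sndBlock {d : ℕ} (k l : Fin d) :
    Matrix (Fin d × Fin d) (Fin d × Fin d) ℂ →ₗ[ℂ] Matrix (Fin d) (Fin d) ℂ where
  toFun ρ := ρ.submatrix (·, k) (·, l)
  map_add' _ _ := rfl
  map_smul' _ _ := rfl

theorem sndBlock_apply {d : ℕ} (k l : Fin d) (ρ : Matrix (Fin d × Fin d) (Fin d × Fin d) ℂ)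
    (i j : Fin d) : sndBlock k l ρ i j = ρ (i, k) (j, l) := rfl

theorem sndBlock_kronecker {d : ℕ} (k l : Fin d) (A B : Matrix (Fin d) (Fin d) ℂ) :
    sndBlock k l (A ⊗ₖ B) = B k l • A := by
  ext i j
  simp [sndBlock_apply, mul_comm]

theorem sndBlock_one {d : ℕ} (k l : Fin d) :
    sndBlock k l 1 = (1 : Matrix (Fin d) (Fin d) ℂ) k l • 1 := by
  rw [← one_kronecker_one, sndBlock_kronecker]

theorem IsCQ.commute_sndBlock {d : ℕ} {ρ : Matrix (Fin d × Fin d) (Fin d × Fin d) ℂ}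
    (h : IsCQ ρ) (k l k' l' : Fin d) : Commute (sndBlock k l ρ) (sndBlock k' l' ρ) := by
  obtain ⟨φ, c, η, hφ, -, -, -, rfl⟩ := h
  simp only [map_sum, map_smul, sndBlock_kronecker]
  refine Commute.sum_left _ _ _ fun i _ => Commute.sum_right _ _ _ fun j _ => ?_
  refine (((Commute.smul_left ?_ _).smul_left _).smul_right _).smul_right _
  rw [commute_iff_eq, vecMulVec_mul_vecMulVec, vecMulVec_mul_vecMulVec, hφ, hφ]
  by_cases hij : i = j
  · rw [hij]
  · simp [hij, Ne.symm hij]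

open scoped MatrixOrder Matrix.Norms.L2Operator in
theorem Matrix.IsHermitian.exists_posSemidef_smul_one_add {n : Type*} [Fintype n] [DecidableEq n]
    {A : Matrix n n ℂ} (hA : A.IsHermitian) :
    ∃ C : ℝ, 0 < C ∧ ((C : ℂ) • 1 + A).PosSemidef ∧ ((C : ℂ) • 1 - A).PosSemidef := by
  have hA' : IsSelfAdjoint A := hA
  have h1 := le_iff.mp hA'.le_algebraMap_norm_self
  have h2 := le_iff.mp hA'.neg_algebraMap_norm_le_self
  have h3 : (1 : Matrix n n ℂ).PosSemidef := .one
  have e : (((‖A‖ + 1 : ℝ) : ℂ) • (1 : Matrix n n ℂ)) = algebraMap ℝ _ ‖A‖ + 1 := by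
    rw [Complex.ofReal_add, Complex.ofReal_one, add_smul, one_smul, Algebra.algebraMap_eq_smul_one,
      Complex.coe_smul]
  refine ⟨‖A‖ + 1, by positivity, ?_, ?_⟩
  · have e₂ : algebraMap ℝ _ ‖A‖ + 1 + A = A - -algebraMap ℝ _ ‖A‖ + 1 := by abel
    rw [e, e₂]
    exact h2.add h3
  · have e₁ : algebraMap ℝ _ ‖A‖ + 1 - A = algebraMap ℝ _ ‖A‖ - A + 1 := by abel
    rw [e, e₁]
    exact h1.add h3

open scoped MatrixOrder Matrix.Norms.L2Operator in
theorem exists_smul_one_of_forall_posSemidef_commute {n : Type*} [Fintype n] [DecidableEq n]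
    {M : Matrix n n ℂ} (hM : ∀ H : Matrix n n ℂ, H.PosSemidef → Commute H M) :
    ∃ x : ℂ, M = x • 1 := by
  have h (X : Matrix n n ℂ) : Commute X M := by
    have hX : X ∈ Submodule.span ℂ {a : Matrix n n ℂ | 0 ≤ a} := by
      rw [CStarAlgebra.span_nonneg]; trivial
    induction hX using Submodule.span_induction with
    | mem H hH => exact hM H (nonneg_iff_posSemidef.mp hH)
    | zero => exact Commute.zero_left _
    | add _ _ _ _ h₁ h₂ => exact h₁.add_left h₂
    | smul a _ _ h => exact h.smul_left a
  obtain ⟨x, rfl⟩ := mem_range_scalar_of_commute_single fun i j _ => h (single i j 1)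
  exact ⟨x, by simp [smul_one_eq_diagonal]⟩

theorem eq_one_kronecker_of_sndBlock {d : ℕ} {Δ : Matrix (Fin d × Fin d) (Fin d × Fin d) ℂ}
    (hd : d ≠ 0) (hΔH : Δ.IsHermitian) (hΔtr : Δ.trace = 0)
    (h : ∀ k l, ∃ x : ℂ, sndBlock k l Δ = x • 1) :
    ∃ Ξ : Matrix (Fin d) (Fin d) ℂ, Ξ.IsHermitian ∧ Ξ.trace = 0 ∧
      Δ = (1 : Matrix (Fin d) (Fin d) ℂ) ⊗ₖ Ξ := by
  choose Ξ hΞ using h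
  have e : Δ = (1 : Matrix (Fin d) (Fin d) ℂ) ⊗ₖ of Ξ := by
    ext ⟨i, k⟩ ⟨j, l⟩
    have := congrFun₂ (hΞ k l) i j
    rw [sndBlock_apply] at this
    rw [this]
    simp [mul_comm]
  refine ⟨of Ξ, ?_, ?_, e⟩
  · ext k l
    have i : Fin d := ⟨0, Nat.pos_of_ne_zero hd⟩
    have := hΔH.apply (i, k) (i, l)
    rw [e] at this
    simpa using this
  · rw [e, trace_kronecker, trace_one, Fintype.card_fin] at hΔtr
    exact (mul_eq_zero.mp hΔtr).resolve_left (by exact_mod_cast hd)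

theorem exists_isCC_smul_one_add_kronecker {d : ℕ} {H : Matrix (Fin d) (Fin d) ℂ}
    (hH : H.PosSemidef) (k : Fin d) :
    ∃ t : ℝ, 0 < t ∧ IsCC ((t : ℂ) • (1 + H ⊗ₖ single k k 1)) := by
  obtain ⟨φ, hφ, hsum⟩ := hH.1.exists_isONB_eq_sum
  set h := hH.1.eigenvalues
  have hh : ∀ i, 0 ≤ h i := hH.eigenvalues_nonneg
  have hc (i j : Fin d) : 0 < 1 + if j = k then h i else 0 := by
    have := hh i
    split_ifs <;> linarith
  set τ := ∑ i, ∑ j, (1 + if j = k then h i else 0)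
  have hτ : 0 < τ :=
    Finset.sum_pos (fun i _ => Finset.sum_pos (fun j _ => hc i j) ⟨k, Finset.mem_univ k⟩)
      ⟨k, Finset.mem_univ k⟩
  refine ⟨τ⁻¹, inv_pos.mpr hτ, φ, fun j => Pi.single j 1,
    fun i j => τ⁻¹ * (1 + if j = k then h i else 0), hφ, isONB_single d,
    fun i j => (mul_pos (inv_pos.mpr hτ) (hc i j)).le, ?_, ?_⟩
  · simp only [← Finset.mul_sum]
    exact inv_mul_cancel₀ hτ.ne'
  · have h1 : (1 : Matrix (Fin d × Fin d) (Fin d × Fin d) ℂ) =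
        (∑ i, vecMulVec (φ i) (star (φ i))) ⊗ₖ 1 := by
      rw [hφ.sum_vecMulVec, one_kronecker_one]
    conv_lhs => rw [h1, hsum]
    ext ⟨a, b⟩ ⟨a', b'⟩
    simp only [Matrix.smul_apply, Matrix.add_apply, kronecker_apply, Matrix.sum_apply, smul_eq_mul, Finset.sum_mul,
      ← Finset.sum_add_distrib, Finset.mul_sum]
    refine Finset.sum_congr rfl fun i _ => ?_
    simp [vecMulVec_apply, Pi.single_apply, single_apply, one_apply, mul_add, add_mul,
      ite_and, mul_ite]
    by_cases hb : b = b'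
    · subst hb
      by_cases hk : b = k
      · simp [hk, mul_assoc]
      · simp [hk, Ne.symm hk]
    · by_cases hk : k = b
      · simp [hb, hk]
      · simp [hb, hk]

theorem IsCC.isState_add_smul {d : ℕ} {Δ H : Matrix (Fin d × Fin d) (Fin d × Fin d) ℂ} {t C : ℝ}
    (ht : 0 < t) (hC : 0 < C) (hH : H.PosSemidef) (hCC : IsCC ((t : ℂ) • (1 + H)))
    (hΔtr : Δ.trace = 0) (hΔ : ((C : ℂ) • 1 + Δ).PosSemidef) :
    IsState ((t : ℂ) • (1 + H) + ((t / C : ℝ) : ℂ) • Δ) := by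
  refine ⟨?_, by rw [trace_add, trace_smul _ Δ, hΔtr, smul_zero, add_zero, hCC.trace_eq_one]⟩
  have e : (t : ℂ) • (1 + H) + ((t / C : ℝ) : ℂ) • Δ =
      ((t / C : ℝ) : ℂ) • ((C : ℂ) • 1 + Δ) + (t : ℂ) • H := by
    have hC' : (C : ℂ) ≠ 0 := by exact_mod_cast hC.ne'
    rw [smul_add _ _ Δ, smul_smul, Complex.ofReal_div, div_mul_cancel₀ _ hC', smul_add]
    abel
  rw [e]
  refine (hΔ.smul ?_).add (hH.smul ?_)
  · exact_mod_cast (div_pos ht hC).le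
  · exact_mod_cast ht.le

theorem commute_of_commute_smul_one_add_add_smul {A : Type*} [Ring A] [Algebra ℂ A]
    {H M N : A} {x : ℂ} {t s : ℝ} (ht : t ≠ 0) (hs : s ≠ 0)
    (h₁ : Commute ((t : ℂ) • (1 + H) + (s : ℂ) • N) ((t : ℂ) • x • 1 + (s : ℂ) • M))
    (h₂ : Commute ((t : ℂ) • (1 + H) + ((-s : ℝ) : ℂ) • N)
      ((t : ℂ) • x • 1 + ((-s : ℝ) : ℂ) • M)) :
    Commute H M := by
  have key : (2 * (t : ℂ) * s) • (H * M - M * H) = 0 := by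
    have h := congrArg₂ (· - ·) h₁.eq h₂.eq
    simp only [mul_add, add_mul, smul_mul_assoc, mul_smul_comm, one_mul, mul_one, smul_add,
      Complex.ofReal_neg] at h
    rw [← sub_eq_zero] at h
    rw [← h]
    module
  refine sub_eq_zero.mp ((smul_eq_zero.mp key).resolve_left ?_)
  exact mul_ne_zero (mul_ne_zero two_ne_zero (by exact_mod_cast ht)) (by exact_mod_cast hs)

theorem commute_of_isCQ_of_isCQ {d : ℕ} {Δ : Matrix (Fin d × Fin d) (Fin d × Fin d) ℂ}
    {H : Matrix (Fin d) (Fin d) ℂ} {k k' l' : Fin d} (hk : k' ≠ k) {t s : ℝ} (ht : t ≠ 0)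
    (hs : s ≠ 0) (h₁ : IsCQ ((t : ℂ) • (1 + H ⊗ₖ single k k 1) + (s : ℂ) • Δ))
    (h₂ : IsCQ ((t : ℂ) • (1 + H ⊗ₖ single k k 1) + ((-s : ℝ) : ℂ) • Δ)) :
    Commute H (sndBlock k' l' Δ) := by
  have c₁ := (h₁.commute_sndBlock k k k' l').eq
  have c₂ := (h₂.commute_sndBlock k k k' l').eq
  have hs0 : (single k k (1 : ℂ)) k' l' = 0 := by simp [hk.symm]
  simp only [map_add, map_smul, sndBlock_one, sndBlock_kronecker, single_apply_same, one_smul,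
    one_apply_eq, hs0, zero_smul, add_zero] at c₁ c₂
  exact commute_of_commute_smul_one_add_add_smul ht hs c₁ c₂

theorem stmt5 (d : ℕ) (hd : 2 ≤ d)
    (Δ : Matrix (Fin d × Fin d) (Fin d × Fin d) ℂ)
    (hΔH : Δ.IsHermitian) (hΔtr : Δ.trace = 0)
    (hΔ : ¬ ∃ Ξ : Matrix (Fin d) (Fin d) ℂ, Ξ.IsHermitian ∧ Ξ.trace = 0 ∧
        Δ = (1 : Matrix (Fin d) (Fin d) ℂ) ⊗ₖ Ξ) :
    ∃ (ρ : Matrix (Fin d × Fin d) (Fin d × Fin d) ℂ) (lam : ℝ),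
      IsCQ ρ ∧ IsCC ρ ∧ IsState (ρ + (lam : ℂ) • Δ) ∧ ¬ IsCQ (ρ + (lam : ℂ) • Δ) := by
  by_contra hcon
  push Not at hcon
  refine hΔ (eq_one_kronecker_of_sndBlock (by omega) hΔH hΔtr fun k' l' =>
    exists_smul_one_of_forall_posSemidef_commute fun H hH => ?_)
  have : Nontrivial (Fin d) := Fin.nontrivial_iff_two_le.mpr hd
  obtain ⟨k, hk⟩ := exists_ne k'
  obtain ⟨t, ht, hCC⟩ := exists_isCC_smul_one_add_kronecker hH k
  obtain ⟨C, hC, hpos, hneg⟩ := hΔH.exists_posSemidef_smul_one_add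
  have hE : (single k k (1 : ℂ)).PosSemidef := by
    rw [← diagonal_single]
    exact .diagonal (Pi.single_nonneg.mpr zero_le_one)
  have hHE := hH.kronecker hE
  have hs := (div_pos ht hC).ne'
  refine commute_of_isCQ_of_isCQ hk.symm ht.ne' hs (hcon _ _ hCC.isCQ hCC ?_)
    (hcon _ _ hCC.isCQ hCC ?_)
  · exact hCC.isState_add_smul ht hC hHE hΔtr hpos
  · have := hCC.isState_add_smul (Δ := -Δ) ht hC hHE (by simp [hΔtr]) (by rwa [← sub_eq_add_neg])
    simpa using this
end
end

section
/- Let d ≥ 2 and let Δ be a nonzero traceless Hermitian matrix on C^d ⊗ C^d. Then there exist a state ρ on C^d ⊗ C^d which is classical-quantum or quantum-classical, and a real number λ, such that ρ + λΔ is a state but is neither classical-quantum nor quantum-classical. -/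
open Matrix
open Kronecker
open scoped ComplexOrder

noncomputable section

/-- The operator on the first factor obtained by fixing a pair of indices on the second factor. -/
def fstBlock {m n : Type*} (X : Matrix (m × n) (m × n) ℂ) (b b' : n) : Matrix m m ℂ :=
  fun a a' => X (a, b) (a', b')

theorem IsCQ.commute_fstBlock {d : ℕ} {ρ : Matrix (Fin d × Fin d) (Fin d × Fin d) ℂ}
    (h : IsCQ ρ) (b b' c c' : Fin d) : Commute (fstBlock ρ b b') (fstBlock ρ c c') := by
  obtain ⟨φ, w, η, hφ, -, -, -, rfl⟩ := h
  have hblock : ∀ b b', fstBlock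
      (∑ i, (w i : ℂ) • (vecMulVec (φ i) (star (φ i)) ⊗ₖ η i)) b b' =
      ∑ i, (w i * η i b b') • vecMulVec (φ i) (star (φ i)) := by
    intro b b'
    ext a a'
    simp only [fstBlock, Matrix.sum_apply, Matrix.smul_apply, kronecker_apply, smul_eq_mul]
    exact Finset.sum_congr rfl fun i _ => by ring
  rw [hblock, hblock]
  refine Commute.sum_left _ _ _ fun i _ => Commute.sum_right _ _ _ fun j _ =>
    (Commute.smul_right ?_ _).smul_left _
  rcases eq_or_ne i j with rfl | hij
  · exact Commute.refl _
  · rw [commute_iff_eq, vecMulVec_mul_vecMulVec, vecMulVec_mul_vecMulVec, hφ i j, hφ j i]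
    simp [hij, hij.symm]

theorem isQC_iff_isCQ_swap {d : ℕ} (ρ : Matrix (Fin d × Fin d) (Fin d × Fin d) ℂ) :
    IsQC ρ ↔ IsCQ (ρ.submatrix Prod.swap Prod.swap) := by
  constructor
  · rintro ⟨χ, c, σ, h1, h2, h3, h4, rfl⟩
    refine ⟨χ, c, σ, h1, h2, h3, h4, ?_⟩
    ext ⟨a, b⟩ ⟨a', b'⟩
    simp only [submatrix_apply, Prod.swap, Matrix.sum_apply, Matrix.smul_apply, kronecker_apply,
      mul_comm]
  · rintro ⟨χ, c, σ, h1, h2, h3, h4, h5⟩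
    refine ⟨χ, c, σ, h1, h2, h3, h4, ?_⟩
    ext ⟨a, b⟩ ⟨a', b'⟩
    have := congrFun (congrFun h5 (b, a)) (b', a')
    simpa only [submatrix_apply, Prod.swap, Matrix.sum_apply, Matrix.smul_apply, kronecker_apply,
      mul_comm] using this

theorem isCQ_iff_isQC_swap {d : ℕ} (ρ : Matrix (Fin d × Fin d) (Fin d × Fin d) ℂ) :
    IsCQ ρ ↔ IsQC (ρ.submatrix Prod.swap Prod.swap) := by
  rw [isQC_iff_isCQ_swap]
  simp

theorem trace_submatrix_swap {d : ℕ} (ρ : Matrix (Fin d × Fin d) (Fin d × Fin d) ℂ) :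
    (ρ.submatrix Prod.swap Prod.swap).trace = ρ.trace :=
  (Equiv.prodComm (Fin d) (Fin d)).sum_comp fun x => ρ x x

theorem IsState.submatrix_swap {d : ℕ} {ρ : Matrix (Fin d × Fin d) (Fin d × Fin d) ℂ}
    (h : IsState ρ) : IsState (ρ.submatrix Prod.swap Prod.swap) :=
  ⟨h.1.submatrix _, by rw [trace_submatrix_swap, h.2]⟩

theorem Matrix.IsHermitian.eventually_posSemidef {n : Type*} [Fintype n] [DecidableEq n]
    {H : Matrix n n ℂ} (hH : H.IsHermitian) {c : ℝ} (hc : 0 < c) :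
    ∀ᶠ s : ℝ in nhds 0, ((c : ℂ) • (1 : Matrix n n ℂ) + (s : ℂ) • H).PosSemidef := by
  have hs : ∀ᶠ s : ℝ in nhds 0, ∀ i, 0 < c + s * hH.eigenvalues i := by
    rw [Filter.eventually_all]
    intro i
    have : ContinuousAt (fun s : ℝ => c + s * hH.eigenvalues i) 0 := by fun_prop
    exact this.eventually_const_lt (by simpa)
  filter_upwards [hs] with s hs
  have hD : (diagonal fun i => ((c + s * hH.eigenvalues i : ℝ) : ℂ)).PosSemidef :=
    PosSemidef.diagonal fun i => Complex.zero_le_real.2 (hs i).le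
  have hU : (hH.eigenvectorUnitary : Matrix n n ℂ) * (hH.eigenvectorUnitary : Matrix n n ℂ)ᴴ = 1 :=
    Unitary.coe_mul_star_self hH.eigenvectorUnitary
  have hsplit : (diagonal fun i => ((c + s * hH.eigenvalues i : ℝ) : ℂ)) =
      (c : ℂ) • 1 + (s : ℂ) • diagonal (RCLike.ofReal ∘ hH.eigenvalues) := by
    ext i j
    by_cases hij : i = j <;> simp [hij]
  have := hD.mul_mul_conjTranspose_same (hH.eigenvectorUnitary : Matrix n n ℂ)
  rw [hsplit, Matrix.mul_add, Matrix.add_mul, Matrix.mul_smul, Matrix.mul_smul, Matrix.smul_mul,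
    Matrix.smul_mul, Matrix.mul_one, hU] at this
  convert this using 3
  exact hH.spectral_theorem

theorem Matrix.IsHermitian.exists_isONB {d : ℕ} {D : Matrix (Fin d) (Fin d) ℂ}
    (hD : D.IsHermitian) :
    ∃ (φ : Fin d → Fin d → ℂ) (e : Fin d → ℝ), IsONB φ ∧
      (∑ i, vecMulVec (φ i) (star (φ i))) = 1 ∧
      (∑ i, (e i : ℂ) • vecMulVec (φ i) (star (φ i))) = D := by
  set U : Matrix (Fin d) (Fin d) ℂ := ↑(hD.eigenvectorUnitary) with hUdef
  have hU : U * Uᴴ = 1 := Unitary.coe_mul_star_self hD.eigenvectorUnitary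
  have hU' : Uᴴ * U = 1 := Unitary.coe_star_mul_self hD.eigenvectorUnitary
  refine ⟨fun i a => U a i, hD.eigenvalues, ?_, ?_, ?_⟩
  · intro i j
    rw [← one_apply, ← hU']
    rfl
  · rw [← hU]
    ext a b
    simp [Matrix.sum_apply, mul_apply, vecMulVec_apply]
  · conv_rhs => rw [hD.spectral_theorem]
    ext a b
    simp only [Matrix.sum_apply, Matrix.smul_apply, vecMulVec_apply, Unitary.conjStarAlgAut_apply,
      mul_apply, diagonal_apply, mul_ite, mul_zero, Finset.sum_ite_eq', Finset.mem_univ, if_true,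
      smul_eq_mul, ← hUdef]
    exact Finset.sum_congr rfl fun i _ => by simp [star_apply, hUdef]; ring

theorem Matrix.exists_isHermitian_not_commute {n : Type*} [Fintype n] [DecidableEq n]
    {M : Matrix n n ℂ} (hM : M ∉ Set.range (scalar n)) :
    ∃ D : Matrix n n ℂ, D.IsHermitian ∧ ¬ Commute D M := by
  by_contra! h
  refine hM (mem_range_scalar_of_commute_single fun i j _ => ?_)
  change Commute (single i j 1) M
  rw [← realPart_add_I_smul_imaginaryPart (single i j (1 : ℂ))]
  exact (h _ (realPart _).2).add_left ((h _ (imaginaryPart _).2).smul_left _)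

theorem exists_traceless_not_commute {d : ℕ} (hd : 2 ≤ d) (p q : Fin d) :
    ∃ K K' : Matrix (Fin d) (Fin d) ℂ, K.IsHermitian ∧ K'.IsHermitian ∧ K.trace = 0 ∧
      K'.trace = 0 ∧ K p q = 0 ∧ ¬ Commute K K' := by
  have key : ∀ i j : Fin d, i ≠ j →
      (single i i 1 - single j j 1 : Matrix (Fin d) (Fin d) ℂ).IsHermitian ∧
      (single i j 1 + single j i 1 : Matrix (Fin d) (Fin d) ℂ).IsHermitian ∧
      (single i i 1 - single j j 1 : Matrix (Fin d) (Fin d) ℂ).trace = 0 ∧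
      (single i j 1 + single j i 1 : Matrix (Fin d) (Fin d) ℂ).trace = 0 ∧
      ¬ Commute (single i i 1 - single j j 1 : Matrix (Fin d) (Fin d) ℂ)
        (single i j 1 + single j i 1) := by
    intro i j hij
    refine ⟨?_, ?_, ?_, ?_, ?_⟩
    · simp [IsHermitian, conjTranspose_single]
    · simp [IsHermitian, conjTranspose_single, add_comm]
    · simp [trace_sub]
    · simp [trace_add, trace_single_eq_of_ne, hij, hij.symm]
    · intro h
      have := congrFun (congrFun h i) j
      simp [Matrix.mul_add, Matrix.sub_mul, Matrix.add_mul, Matrix.mul_sub, hij, hij.symm] at this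
      norm_num [single_apply, hij, hij.symm] at this
  by_cases hpq : p = q
  · subst hpq
    have : Nontrivial (Fin d) := Fin.nontrivial_iff_two_le.2 hd
    obtain ⟨q, hq⟩ := exists_ne p
    obtain ⟨h1, h2, h3, h4, h5⟩ := key p q hq.symm
    exact ⟨_, _, h2, h1, h4, h3, by simp [hq], fun h => h5 h.symm⟩
  · obtain ⟨h1, h2, h3, h4, h5⟩ := key p q hpq
    exact ⟨_, _, h1, h2, h3, h4, by simp [hpq, Ne.symm hpq], h5⟩

theorem eventually_isCQ {d : ℕ} (hd : 0 < d) {D K K' : Matrix (Fin d) (Fin d) ℂ}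
    (hD : D.IsHermitian) (hK : K.IsHermitian) (hK' : K'.IsHermitian) (hKt : K.trace = 0)
    (hKt' : K'.trace = 0) :
    ∀ᶠ s : ℝ in nhds 0, IsCQ ((((d * d : ℝ)⁻¹ : ℝ) : ℂ) • 1 + (s : ℂ) • (D ⊗ₖ K + 1 ⊗ₖ K')) := by
  obtain ⟨φ, e, hφ, hone, rfl⟩ := hD.exists_isONB
  have hd' : (0 : ℝ) < d := by exact_mod_cast hd
  have hdc : (d : ℂ) ≠ 0 := by exact_mod_cast hd.ne'
  have hH : ∀ i, ((d * e i : ℂ) • K + (d : ℂ) • K').IsHermitian := fun i => by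
    simp [IsHermitian, conjTranspose_add, conjTranspose_smul, hK.eq, hK'.eq]
  have hs := Filter.eventually_all.2 fun i => (hH i).eventually_posSemidef (inv_pos.2 hd')
  filter_upwards [hs] with s hs
  refine ⟨φ, fun _ => (d : ℝ)⁻¹, _, hφ, fun _ => by positivity, ?_, fun i => ⟨hs i, ?_⟩, ?_⟩
  · simp [hd'.ne']
  · simp [trace_add, trace_smul, hKt, hKt', hdc]
  · rw [← one_kronecker_one, show (1 : Matrix (Fin d) (Fin d) ℂ) ⊗ₖ 1 =
        (∑ i, vecMulVec (φ i) (star (φ i))) ⊗ₖ 1 by rw [hone], show 1 ⊗ₖ K' =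
        (∑ i, vecMulVec (φ i) (star (φ i))) ⊗ₖ K' by rw [hone]]
    ext ⟨a, b⟩ ⟨a', b'⟩
    simp only [Matrix.add_apply, Matrix.smul_apply, kronecker_apply, Matrix.sum_apply, smul_eq_mul,
      Finset.sum_mul, Finset.mul_sum, ← Finset.sum_add_distrib]
    refine Finset.sum_congr rfl fun i _ => ?_
    push_cast
    field_simp

theorem not_commute_smul_one_add {n : Type*} [Fintype n] [DecidableEq n] {A B : Matrix n n ℂ}
    (h : ¬ Commute A B) {s : ℂ} (hs : s ≠ 0) (u v : ℂ) :
    ¬ Commute (u • 1 + s • A) (v • 1 + s • B) := by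
  intro hc
  apply h
  have h1 : Commute (s • A) (v • 1 + s • B) := by
    simpa using hc.sub_left ((Commute.one_left _).smul_left u)
  have h2 : Commute (s • A) (s • B) := by
    simpa using h1.sub_right ((Commute.one_right _).smul_right v)
  simpa [hs] using h2

theorem not_isCQ_of_not_commute {d : ℕ} {Y : Matrix (Fin d × Fin d) (Fin d × Fin d) ℂ}
    {b b' c c' : Fin d} (h : ¬ Commute (fstBlock Y b b') (fstBlock Y c c')) (r : ℂ) {s : ℂ}
    (hs : s ≠ 0) : ¬ IsCQ (r • 1 + s • Y) := by
  have hb : ∀ b b', fstBlock (r • 1 + s • Y) b b' =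
      (r * (1 : Matrix (Fin d) (Fin d) ℂ) b b') • 1 + s • fstBlock Y b b' := by
    intro b b'
    ext a a'
    simp only [fstBlock, ← one_kronecker_one, Matrix.add_apply, Matrix.smul_apply,
      kronecker_apply, smul_eq_mul]
    ring
  intro hcq
  have := hcq.commute_fstBlock b b' c c'
  rw [hb, hb] at this
  exact not_commute_smul_one_add h hs _ _ this

theorem eventually_not_commute_fst {d : ℕ} (Δ : Matrix (Fin d × Fin d) (Fin d × Fin d) ℂ)
    {D K K' : Matrix (Fin d) (Fin d) ℂ} {b b' p q : Fin d}
    (hD : ¬ Commute D (fstBlock Δ p q)) (hK : K b b' ≠ 0) (hpq : K p q = 0) :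
    ∀ᶠ t : ℝ in nhdsWithin 0 {0}ᶜ,
      ¬ Commute (fstBlock (D ⊗ₖ K + 1 ⊗ₖ K' + (t : ℂ) • Δ) b b')
        (fstBlock (D ⊗ₖ K + 1 ⊗ₖ K' + (t : ℂ) • Δ) p q) := by
  set M := fstBlock Δ p q
  set N := fstBlock Δ b b'
  have hblock : ∀ (t : ℝ) b b', fstBlock (D ⊗ₖ K + 1 ⊗ₖ K' + (t : ℂ) • Δ) b b' =
      K b b' • D + K' b b' • 1 + (t : ℂ) • fstBlock Δ b b' := by
    intro t b b'
    ext a a'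
    simp [fstBlock, mul_comm]
  have hne : ∀ᶠ t : ℝ in nhds 0, K b b' • (D * M - M * D) + (t : ℂ) • (N * M - M * N) ≠ 0 := by
    have : ContinuousAt
        (fun t : ℝ => K b b' • (D * M - M * D) + (t : ℂ) • (N * M - M * N)) 0 := by fun_prop
    refine this.eventually_ne ?_
    simpa [hK, sub_eq_zero, commute_iff_eq] using hD
  filter_upwards [hne.filter_mono nhdsWithin_le_nhds, self_mem_nhdsWithin] with t ht ht0 hc
  rw [hblock, hblock, hpq] at hc
  change Commute (_ + (t : ℂ) • N) (_ + (t : ℂ) • M) at hc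
  have ht0' : (t : ℂ) ≠ 0 := by exact_mod_cast ht0
  apply ht
  refine (smul_eq_zero_iff_right ht0').1 (Eq.trans ?_ (sub_eq_zero.2 hc.eq))
  clear_value M N
  simp only [Matrix.add_mul, Matrix.mul_add, Matrix.smul_mul, Matrix.mul_smul, Matrix.one_mul,
    Matrix.mul_one, Matrix.mul_zero, Matrix.zero_mul, smul_sub, smul_add, smul_smul, zero_smul,
    smul_zero]
  module

theorem eventually_not_commute_snd {d : ℕ} (Δ : Matrix (Fin d × Fin d) (Fin d × Fin d) ℂ)
    {D K K' : Matrix (Fin d) (Fin d) ℂ} (hD : D ∉ Set.range (scalar (Fin d)))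
    (hK : ¬ Commute K K') :
    ∃ a a' c c', ∀ᶠ t : ℝ in nhds 0,
      ¬ Commute
        (fstBlock ((D ⊗ₖ K + 1 ⊗ₖ K' + (t : ℂ) • Δ).submatrix Prod.swap Prod.swap) a a')
        (fstBlock ((D ⊗ₖ K + 1 ⊗ₖ K' + (t : ℂ) • Δ).submatrix Prod.swap Prod.swap) c c') := by
  obtain ⟨a, a', c, hac⟩ : ∃ a a' c, D a a' ≠ (1 : Matrix (Fin d) (Fin d) ℂ) a a' * D c c := by
    by_contra! h
    rcases isEmpty_or_nonempty (Fin d) with _ | ⟨⟨c⟩⟩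
    · exact hD ⟨0, Subsingleton.elim _ _⟩
    · refine hD ⟨D c c, ?_⟩
      ext a a'
      rw [h a a' c]
      by_cases haa : a = a' <;> simp [haa, one_apply]
  refine ⟨a, a', c, c, ?_⟩
  have hblock : ∀ (t : ℝ) a a',
      fstBlock ((D ⊗ₖ K + 1 ⊗ₖ K' + (t : ℂ) • Δ).submatrix Prod.swap Prod.swap) a a' =
      D a a' • K + (1 : Matrix (Fin d) (Fin d) ℂ) a a' • K' +
        (t : ℂ) • fstBlock (Δ.submatrix Prod.swap Prod.swap) a a' := by
    intro t a a'
    ext b b'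
    simp [fstBlock]
  simp only [hblock]
  set P := fstBlock (Δ.submatrix Prod.swap Prod.swap) a a'
  set Q := fstBlock (Δ.submatrix Prod.swap Prod.swap) c c
  set x := D a a'
  set y := (1 : Matrix (Fin d) (Fin d) ℂ) a a'
  have hcont : ContinuousAt (fun t : ℝ =>
      (x • K + y • K' + (t : ℂ) • P) *
          (D c c • K + (1 : Matrix (Fin d) (Fin d) ℂ) c c • K' + (t : ℂ) • Q) -
        (D c c • K + (1 : Matrix (Fin d) (Fin d) ℂ) c c • K' + (t : ℂ) • Q) *
          (x • K + y • K' + (t : ℂ) • P)) 0 := by fun_prop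
  refine (hcont.eventually_ne ?_).mono fun t ht hc => ht (sub_eq_zero.2 hc.eq)
  have hval : (x • K + y • K') * (D c c • K + K') - (D c c • K + K') * (x • K + y • K') =
      (x - y * D c c) • (K * K' - K' * K) := by
    simp only [Matrix.add_mul, Matrix.mul_add, Matrix.smul_mul, Matrix.mul_smul, smul_add,
      smul_smul]
    module
  simp only [Complex.ofReal_zero, zero_smul, add_zero, one_apply_eq, one_smul, hval]
  exact smul_ne_zero (sub_ne_zero.2 hac) (sub_ne_zero.2 hK)

theorem exists_isCQ_of_fstBlock_notMem_range_scalar {d : ℕ} (hd : 2 ≤ d)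
    {Δ : Matrix (Fin d × Fin d) (Fin d × Fin d) ℂ} (hΔH : Δ.IsHermitian) (hΔtr : Δ.trace = 0)
    {p q : Fin d} (hpq : fstBlock Δ p q ∉ Set.range (scalar (Fin d))) :
    ∃ (ρ : Matrix (Fin d × Fin d) (Fin d × Fin d) ℂ) (lam : ℝ),
      IsCQ ρ ∧ IsState (ρ + (lam : ℂ) • Δ) ∧
        ¬ IsCQ (ρ + (lam : ℂ) • Δ) ∧ ¬ IsQC (ρ + (lam : ℂ) • Δ) := by
  obtain ⟨D, hD, hDM⟩ := exists_isHermitian_not_commute hpq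
  obtain ⟨K, K', hK, hK', hKt, hKt', hKpq, hKK'⟩ := exists_traceless_not_commute hd p q
  obtain ⟨b, b', hb⟩ : ∃ b b', K b b' ≠ 0 := by
    by_contra! h
    obtain rfl : K = 0 := by ext i j; exact h i j
    exact hKK' (Commute.zero_left _)
  have hDs : D ∉ Set.range (scalar (Fin d)) := by
    rintro ⟨r, rfl⟩
    exact hDM (scalar_commute r (fun r' => mul_comm _ _) _)
  obtain ⟨a, a', c, c', hsnd⟩ := eventually_not_commute_snd Δ hDs hKK'
  obtain ⟨t, ht1, ht2⟩ := ((hsnd.filter_mono nhdsWithin_le_nhds).and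
    (eventually_not_commute_fst Δ (K' := K') hDM hb hKpq)).exists
  set X := D ⊗ₖ K + 1 ⊗ₖ K' with hX
  have hXH : (X + (t : ℂ) • Δ).IsHermitian := by
    have h1 : (D ⊗ₖ K).IsHermitian := by
      rw [IsHermitian, conjTranspose_kronecker, hD.eq, hK.eq]
    have h2 : ((1 : Matrix (Fin d) (Fin d) ℂ) ⊗ₖ K').IsHermitian := by
      rw [IsHermitian, conjTranspose_kronecker, conjTranspose_one, hK'.eq]
    have h3 : ((t : ℂ) • Δ).IsHermitian := by
      rw [IsHermitian, conjTranspose_smul, hΔH.eq]; simp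
    exact (h1.add h2).add h3
  have hd0 : 0 < d := by omega
  have hdc : (d : ℂ) ≠ 0 := by exact_mod_cast hd0.ne'
  have hpos : (0 : ℝ) < (d * d : ℝ)⁻¹ := by positivity
  obtain ⟨s, ⟨hs1, hs2⟩, hs0⟩ := ((((eventually_isCQ hd0 hD hK hK' hKt hKt').and
    (hXH.eventually_posSemidef hpos)).filter_mono nhdsWithin_le_nhds).and
    (self_mem_nhdsWithin (s := ({0} : Set ℝ)ᶜ))).exists
  have hsc : (s : ℂ) ≠ 0 := by exact_mod_cast hs0
  have heq : (((d * d : ℝ)⁻¹ : ℝ) : ℂ) • 1 + (s : ℂ) • X + ((s * t : ℝ) : ℂ) • Δ =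
      (((d * d : ℝ)⁻¹ : ℝ) : ℂ) • 1 + (s : ℂ) • (X + (t : ℂ) • Δ) := by
    push_cast
    module
  refine ⟨_, s * t, hs1, ?_⟩
  rw [heq]
  refine ⟨⟨hs2, ?_⟩, not_isCQ_of_not_commute ht2 _ hsc, ?_⟩
  · simp only [hX, trace_add, trace_smul, trace_kronecker, hKt, hKt', hΔtr, trace_one]
    simp
    field_simp
  · rw [isQC_iff_isCQ_swap]
    have hone : (1 : Matrix (Fin d × Fin d) (Fin d × Fin d) ℂ).submatrix Prod.swap Prod.swap = 1 :=
      submatrix_one _ Prod.swap_injective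
    rw [submatrix_add, submatrix_smul, submatrix_smul]
    simp only [Pi.add_apply, Pi.smul_apply, hone]
    exact not_isCQ_of_not_commute ht1 _ hsc

theorem eq_zero_of_fstBlock_mem_range_scalar {d : ℕ}
    {Δ : Matrix (Fin d × Fin d) (Fin d × Fin d) ℂ} (hΔtr : Δ.trace = 0)
    (h1 : ∀ p q, fstBlock Δ p q ∈ Set.range (scalar (Fin d)))
    (h2 : ∀ p q, fstBlock (Δ.submatrix Prod.swap Prod.swap) p q ∈ Set.range (scalar (Fin d))) :
    Δ = 0 := by
  choose k hk using h1
  choose l hl using h2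
  have hk' : ∀ a b a' b', Δ (a, b) (a', b') = if a = a' then k b b' else 0 := fun a b a' b' => by
    have := congrFun (congrFun (hk b b') a) a'
    simpa [fstBlock, diagonal_apply] using this.symm
  have hl' : ∀ a b a' b', Δ (a, b) (a', b') = if b = b' then l a a' else 0 := fun a b a' b' => by
    have := congrFun (congrFun (hl a a') b) b'
    simpa [fstBlock, diagonal_apply] using this.symm
  have hdiag : ∀ x y, Δ x x = Δ y y := by
    rintro ⟨a, b⟩ ⟨a', b'⟩
    calc Δ (a, b) (a, b) = Δ (a', b) (a', b) := by simp [hk']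
      _ = Δ (a', b') (a', b') := by simp [hl']
  ext x y
  rcases eq_or_ne x y with rfl | hxy
  · have hcard : (Fintype.card (Fin d × Fin d) : ℂ) * Δ x x = 0 := by
      rw [← hΔtr, trace]
      simp [hdiag _ x]
    have : Nonempty (Fin d × Fin d) := ⟨x⟩
    exact (mul_eq_zero.1 hcard).resolve_left (Nat.cast_ne_zero.2 Fintype.card_ne_zero)
  · obtain ⟨a, b⟩ := x
    obtain ⟨a', b'⟩ := y
    by_cases ha : a = a'
    · have hb : b ≠ b' := fun hb => hxy (by rw [ha, hb])
      simp [hl', hb]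
    · simp [hk', ha]

theorem stmt7 (d : ℕ) (hd : 2 ≤ d)
    (Δ : Matrix (Fin d × Fin d) (Fin d × Fin d) ℂ)
    (hΔ0 : Δ ≠ 0) (hΔH : Δ.IsHermitian) (hΔtr : Δ.trace = 0) :
    ∃ (ρ : Matrix (Fin d × Fin d) (Fin d × Fin d) ℂ) (lam : ℝ),
      (IsCQ ρ ∨ IsQC ρ) ∧ IsState (ρ + (lam : ℂ) • Δ) ∧
        ¬ IsCQ (ρ + (lam : ℂ) • Δ) ∧ ¬ IsQC (ρ + (lam : ℂ) • Δ) := by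
  by_cases h1 : ∀ p q, fstBlock Δ p q ∈ Set.range (scalar (Fin d))
  · have h2 : ¬ ∀ p q,
        fstBlock (Δ.submatrix Prod.swap Prod.swap) p q ∈ Set.range (scalar (Fin d)) :=
      fun h2 => hΔ0 (eq_zero_of_fstBlock_mem_range_scalar hΔtr h1 h2)
    push Not at h2
    obtain ⟨p, q, hpq⟩ := h2
    obtain ⟨ρ, lam, h3, h4, h5, h6⟩ := exists_isCQ_of_fstBlock_notMem_range_scalar hd
      (hΔH.submatrix Prod.swap) ((trace_submatrix_swap Δ).trans hΔtr) hpq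
    have hswap : (ρ + (lam : ℂ) • Δ.submatrix Prod.swap Prod.swap).submatrix
        Prod.swap Prod.swap = ρ.submatrix Prod.swap Prod.swap + (lam : ℂ) • Δ := by
      ext
      simp
    refine ⟨ρ.submatrix Prod.swap Prod.swap, lam, Or.inr ((isCQ_iff_isQC_swap ρ).1 h3), ?_⟩
    rw [← hswap, ← isCQ_iff_isQC_swap, ← isQC_iff_isCQ_swap]
    exact ⟨h4.submatrix_swap, h6, h5⟩
  · push Not at h1
    obtain ⟨p, q, hpq⟩ := h1
    obtain ⟨ρ, lam, h3, h⟩ := exists_isCQ_of_fstBlock_notMem_range_scalar hd hΔH hΔtr hpq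
    exact ⟨ρ, lam, Or.inl h3, h⟩
end
end

section
/- Let d ≥ 2 and let Δ be a nonzero traceless Hermitian matrix on C^d ⊗ C^d. Then there exist a separable state ρ on C^d ⊗ C^d and a real number λ such that ρ + λΔ is an entangled state. -/
open Matrix
open Kronecker
open scoped ComplexOrder

noncomputable section

/-- Separable states: finite convex combinations `ρ = ∑ᵢ cᵢ σᵢ ⊗ ηᵢ` of product states. -/
def IsSep {d : ℕ} (ρ : Matrix (Fin d × Fin d) (Fin d × Fin d) ℂ) : Prop :=
  ∃ (n : ℕ) (c : Fin n → ℝ) (σ η : Fin n → Matrix (Fin d) (Fin d) ℂ),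
    (∀ i, 0 ≤ c i) ∧ ((∑ i, c i) = 1) ∧ (∀ i, IsState (σ i)) ∧ (∀ i, IsState (η i)) ∧
    ρ = ∑ i, (c i : ℂ) • (σ i ⊗ₖ η i)

/-- The orthogonal projection onto the line spanned by `a`. -/
def lineProj {n : Type*} [Fintype n] (a : n → ℂ) : Matrix n n ℂ :=
  (star a ⬝ᵥ a)⁻¹ • vecMulVec a (star a)

lemma lineProj_posSemidef {n : Type*} [Fintype n] (a : n → ℂ) : (lineProj a).PosSemidef :=
  (posSemidef_vecMulVec_self_star a).smul (inv_nonneg.2 (dotProduct_star_self_nonneg a))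

lemma isState_lineProj {n : Type*} [Fintype n] {a : n → ℂ} (ha : a ≠ 0) :
    IsState (lineProj a) := by
  refine ⟨lineProj_posSemidef a, ?_⟩
  have h : star a ⬝ᵥ a ≠ 0 := by simpa using ha
  rw [lineProj, trace_smul, trace_vecMulVec, dotProduct_comm a, smul_eq_mul, inv_mul_cancel₀ h]

lemma lineProj_mulVec {n : Type*} [Fintype n] (a x : n → ℂ) :
    lineProj a *ᵥ x = ((star a ⬝ᵥ a)⁻¹ * (star a ⬝ᵥ x)) • a := by
  rw [lineProj, smul_mulVec, vecMulVec_mulVec, mul_smul]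
  ext i
  simp [mul_comm]

/-- The normalized projection onto the orthogonal complement of `u`. -/
def orthState {d : ℕ} (u : Fin d → ℂ) : Matrix (Fin d) (Fin d) ℂ :=
  ((d : ℂ) - 1)⁻¹ • (1 - lineProj u)

lemma orthState_mulVec_self {d : ℕ} {u : Fin d → ℂ} (hu : u ≠ 0) : orthState u *ᵥ u = 0 := by
  have h : star u ⬝ᵥ u ≠ 0 := by simpa using hu
  rw [orthState, smul_mulVec, sub_mulVec, lineProj_mulVec, inv_mul_cancel₀ h]
  simp

lemma natCast_sub_one_pos {d : ℕ} (hd : 2 ≤ d) : (0 : ℂ) < (d : ℂ) - 1 := by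
  have : (1 : ℝ) < d := by exact_mod_cast hd
  have h : (0 : ℝ) < (d : ℝ) - 1 := by linarith
  exact_mod_cast h

lemma isState_orthState {d : ℕ} (hd : 2 ≤ d) {u : Fin d → ℂ} (hu : u ≠ 0) :
    IsState (orthState u) := by
  have hd' := natCast_sub_one_pos hd
  have hherm := (lineProj_posSemidef u).isHermitian
  have hidem : lineProj u * lineProj u = lineProj u := by
    have h : star u ⬝ᵥ u ≠ 0 := by simpa using hu
    have : lineProj u * vecMulVec u (star u) = vecMulVec u (star u) := by
      rw [mul_vecMulVec, lineProj_mulVec, inv_mul_cancel₀ h, one_smul]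
    calc lineProj u * lineProj u = (star u ⬝ᵥ u)⁻¹ • (lineProj u * vecMulVec u (star u)) :=
          mul_smul_comm _ _ _
      _ = lineProj u := by rw [this, lineProj]
  refine ⟨PosSemidef.smul ?_ (inv_nonneg.2 hd'.le), ?_⟩
  · have h := posSemidef_conjTranspose_mul_self (1 - lineProj u)
    rw [conjTranspose_sub, conjTranspose_one, hherm.eq, IsIdempotentElem.one_sub (a := lineProj u) hidem] at h
    exact h
  · rw [orthState, trace_smul, trace_sub, (isState_lineProj hu).2, trace_one, Fintype.card_fin,
      smul_eq_mul, inv_mul_cancel₀ hd'.ne']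

lemma exists_eq_smul_of_orthState_mulVec_eq_zero {d : ℕ} (hd : 2 ≤ d) {u y : Fin d → ℂ}
    (h : orthState u *ᵥ y = 0) : ∃ c : ℂ, y = c • u := by
  have hd' := (natCast_sub_one_pos hd).ne'
  rw [orthState, smul_mulVec, smul_eq_zero, sub_mulVec, one_mulVec, lineProj_mulVec] at h
  exact ⟨_, sub_eq_zero.1 (h.resolve_left (inv_ne_zero hd'))⟩

/-- The partial transpose on the first tensor factor. -/
def partialTranspose {m n : Type*} (τ : Matrix (m × n) (m × n) ℂ) : Matrix (m × n) (m × n) ℂ :=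
  of fun p q => τ (q.1, p.2) (p.1, q.2)

lemma partialTranspose_kronecker {m n : Type*} (σ : Matrix m m ℂ) (η : Matrix n n ℂ) :
    partialTranspose (σ ⊗ₖ η) = σᵀ ⊗ₖ η := by
  ext p q; simp [partialTranspose]

lemma partialTranspose_add {m n : Type*} (σ τ : Matrix (m × n) (m × n) ℂ) :
    partialTranspose (σ + τ) = partialTranspose σ + partialTranspose τ := rfl

lemma partialTranspose_smul {m n : Type*} (c : ℂ) (τ : Matrix (m × n) (m × n) ℂ) :
    partialTranspose (c • τ) = c • partialTranspose τ := rfl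

lemma partialTranspose_sum {m n ι : Type*} (s : Finset ι) (τ : ι → Matrix (m × n) (m × n) ℂ) :
    partialTranspose (∑ i ∈ s, τ i) = ∑ i ∈ s, partialTranspose (τ i) := by
  ext p q; simp [partialTranspose, Matrix.sum_apply]

lemma partialTranspose_isHermitian {m n : Type*} {τ : Matrix (m × n) (m × n) ℂ}
    (h : τ.IsHermitian) : (partialTranspose τ).IsHermitian := by
  ext p q
  exact h.apply _ _

lemma partialTranspose_ne_zero {m n : Type*} {τ : Matrix (m × n) (m × n) ℂ} (h : τ ≠ 0) :
    partialTranspose τ ≠ 0 := by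
  contrapose! h
  ext p q
  simpa [partialTranspose] using congrFun (congrFun h (q.1, p.2)) (p.1, q.2)

/-- The Peres criterion. -/
lemma IsSep.posSemidef_partialTranspose {d : ℕ} {ρ : Matrix (Fin d × Fin d) (Fin d × Fin d) ℂ}
    (h : IsSep ρ) : (partialTranspose ρ).PosSemidef := by
  obtain ⟨n, c, σ, η, hc, -, hσ, hη, rfl⟩ := h
  rw [partialTranspose_sum]
  refine posSemidef_sum _ fun i _ => ?_
  rw [partialTranspose_smul, partialTranspose_kronecker]
  exact ((hσ i).1.transpose.kronecker (hη i).1).smul (by exact_mod_cast hc i)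

lemma exists_quadForm_ne_zero {n : Type*} [Fintype n] {G : Matrix n n ℂ} (hG : G.IsHermitian)
    (h0 : G ≠ 0) : ∃ v : n → ℂ, star v ⬝ᵥ (G *ᵥ v) ≠ 0 := by
  classical
  by_contra! h
  refine h0 ?_
  have hp : G.PosSemidef := .of_dotProduct_mulVec_nonneg hG fun x => (h x).ge
  ext i j
  have := (hp.dotProduct_mulVec_zero_iff (Pi.single j 1)).1 (h _)
  simpa using congrFun this i

lemma eventually_det_add_smul_one_ne_zero {d : ℕ} (M : Matrix (Fin d) (Fin d) ℂ) :
    ∀ᶠ t : ℂ in nhdsWithin 0 {0}ᶜ, (M + t • (1 : Matrix (Fin d) (Fin d) ℂ)).det ≠ 0 := by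
  have hfin : {t : ℂ | (-M).charpoly.IsRoot t}.Finite :=
    Polynomial.finite_setOfPred_isRoot (charpoly_monic _).ne_zero
  have h : ∀ᶠ t : ℂ in nhdsWithin 0 {0}ᶜ, t ∉ {t : ℂ | (-M).charpoly.IsRoot t} := by
    have := (hfin.subset Set.sdiff_subset : ({t : ℂ | (-M).charpoly.IsRoot t} \ {0}).Finite)
    filter_upwards [nhdsWithin_le_nhds (this.isClosed.isOpen_compl.mem_nhds (by simp)),
      self_mem_nhdsWithin] with t ht ht0 hr
    exact ht ⟨hr, ht0⟩
  filter_upwards [h] with t ht h0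
  refine ht ?_
  change Polynomial.eval t (-M).charpoly = 0
  rw [eval_charpoly, ← h0]
  congr 1
  rw [sub_neg_eq_add, add_comm, scalar_apply, smul_one_eq_diagonal]

lemma exists_isUnit_quadForm_vec_ne_zero {d : ℕ}
    {G : Matrix (Fin d × Fin d) (Fin d × Fin d) ℂ} (hG : G.IsHermitian) (h0 : G ≠ 0) :
    ∃ M : Matrix (Fin d) (Fin d) ℂ, IsUnit M ∧ star (vec M) ⬝ᵥ (G *ᵥ vec M) ≠ 0 := by
  obtain ⟨v, hv⟩ := exists_quadForm_ne_zero hG h0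
  set M₀ : Matrix (Fin d) (Fin d) ℂ := of fun i j => v (j, i) with hM₀
  let f : ℂ → ℂ := fun t => star (vec (M₀ + t • 1)) ⬝ᵥ (G *ᵥ vec (M₀ + t • 1))
  have hf : Continuous f := by
    have : Continuous fun t : ℂ => vec (M₀ + t • (1 : Matrix (Fin d) (Fin d) ℂ)) := by
      refine continuous_pi fun p => ?_
      simp only [vec, Matrix.add_apply, Matrix.smul_apply]
      fun_prop
    exact this.star.dotProduct (continuous_const.matrix_mulVec this)
  have hf0 : f 0 ≠ 0 := by
    have : vec (M₀ + (0 : ℂ) • 1) = v := by ext p; simp [vec, hM₀]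
    simp only [f, this]
    exact hv
  obtain ⟨t, h1, h2⟩ := ((eventually_det_add_smul_one_ne_zero M₀).and
    (nhdsWithin_le_nhds (hf.continuousAt.eventually_ne hf0))).exists
  exact ⟨_, (isUnit_iff_isUnit_det _).2 h1.isUnit, h2⟩

section
open scoped MatrixOrder Matrix.Norms.L2Operator

lemma exists_pos_perturb_posSemidef {n : Type*} [Fintype n] [DecidableEq n] {ρ Δ : Matrix n n ℂ}
    (hρ : ρ.PosDef) (hΔ : Δ.IsHermitian) :
    ∃ ε : ℝ, 0 < ε ∧ (ρ + (ε : ℂ) • Δ).PosSemidef ∧ (ρ + ((-ε : ℝ) : ℂ) • Δ).PosSemidef := by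
  cases isEmpty_or_nonempty n
  · refine ⟨1, one_pos, ?_, ?_⟩ <;> rw [Subsingleton.elim (_ + _) (0 : Matrix n n ℂ)] <;> exact .zero
  have hsa : IsSelfAdjoint Δ := hΔ
  obtain ⟨r, hr, hle⟩ := (CFC.exists_pos_algebraMap_le_iff (a := ρ) hρ.isHermitian).2
    fun x hx => hρ.isStrictlyPositive.spectrum_pos hx
  have h1 := hsa.le_algebraMap_norm_self
  have h2 := hsa.neg_algebraMap_norm_le_self
  rw [Matrix.le_iff] at hle h1 h2
  have hN : 0 < ‖Δ‖ + 1 := by positivity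
  have hε : 0 < r / (‖Δ‖ + 1) := div_pos hr hN
  have hrε : r = r / (‖Δ‖ + 1) * ‖Δ‖ + r / (‖Δ‖ + 1) := by field_simp
  set ε := r / (‖Δ‖ + 1)
  have hε' : (0 : ℂ) ≤ ε := by exact_mod_cast hε.le
  have hone : ((ε : ℂ) • (1 : Matrix n n ℂ)).PosSemidef := PosSemidef.one.smul hε'
  have hρε : ρ - algebraMap ℝ (Matrix n n ℂ) r =
      ρ - ((ε : ℂ) * (‖Δ‖ : ℂ) + (ε : ℂ)) • (1 : Matrix n n ℂ) := by
    rw [hrε, Algebra.algebraMap_eq_smul_one, ← Complex.coe_smul]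
    push_cast
    rfl
  have hnorm : algebraMap ℝ (Matrix n n ℂ) ‖Δ‖ = (‖Δ‖ : ℂ) • (1 : Matrix n n ℂ) := by
    rw [Algebra.algebraMap_eq_smul_one, ← Complex.coe_smul]
  rw [hρε] at hle
  rw [hnorm] at h1 h2
  have hplus : ρ + (ε : ℂ) • Δ = ρ - ((ε : ℂ) * (‖Δ‖ : ℂ) + (ε : ℂ)) • (1 : Matrix n n ℂ) +
      (ε : ℂ) • (Δ - -((‖Δ‖ : ℂ) • (1 : Matrix n n ℂ))) + (ε : ℂ) • (1 : Matrix n n ℂ) := by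
    module
  have hminus : ρ + ((-ε : ℝ) : ℂ) • Δ =
      ρ - ((ε : ℂ) * (‖Δ‖ : ℂ) + (ε : ℂ)) • (1 : Matrix n n ℂ) +
      (ε : ℂ) • ((‖Δ‖ : ℂ) • (1 : Matrix n n ℂ) - Δ) + (ε : ℂ) • (1 : Matrix n n ℂ) := by
    push_cast
    module
  refine ⟨ε, hε, ?_, ?_⟩
  · rw [hplus]
    exact (PosSemidef.add hle (h2.smul hε')).add hone
  · rw [hminus]
    exact (PosSemidef.add hle (h1.smul hε')).add hone

end

/-- The test vectors `e i + z • e j` with `z = 1` or `z = I`. -/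
def testVec {d : ℕ} (p : Fin d × Fin d × Bool) : Fin d → ℂ :=
  Pi.single p.1 1 + (if p.2.2 then Complex.I else 1) • Pi.single p.2.1 1

lemma testVec_ne_zero {d : ℕ} (p : Fin d × Fin d × Bool) : testVec p ≠ 0 := by
  intro h
  have h1 := congrFun h p.1
  obtain ⟨i, j, b⟩ := p
  by_cases hij : i = j
  · subst hij
    cases b
    · norm_num [testVec] at h1
    · have := congrArg Complex.re h1
      simp [testVec] at this
  · cases b <;> simp [testVec, hij] at h1

lemma eq_zero_of_mulVec_star_testVec {d : ℕ} (hd : 2 ≤ d) {Y : Matrix (Fin d) (Fin d) ℂ}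
    (h : ∀ p, ∃ c : ℂ, Y *ᵥ star (testVec p) = c • testVec p) : Y = 0 := by
  have : Nontrivial (Fin d) := Fin.nontrivial_iff_two_le.2 hd
  have hoff : ∀ k i, k ≠ i → Y k i = 0 := by
    intro k i hki
    obtain ⟨c, hc⟩ := h (i, i, false)
    have := congrFun hc k
    simp [testVec, mulVec_add, hki] at this
    simpa [← two_mul] using this
  ext k i
  by_cases hki : k = i
  swap
  · exact hoff k i hki
  subst hki
  obtain ⟨j, hj⟩ := exists_ne k
  obtain ⟨c, hc⟩ := h (k, j, false)
  obtain ⟨c', hc'⟩ := h (k, j, true)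
  have e1 := congrFun hc k
  have e2 := congrFun hc j
  have e3 := congrFun hc' k
  have e4 := congrFun hc' j
  simp [testVec, mulVec_add, mulVec_neg, mulVec_smul, hj, hj.symm, hoff k j hj.symm, hoff j k hj] at e1 e2 e3 e4
  have e5 : -Y j j = c' := mul_right_cancel₀ Complex.I_ne_zero (by linear_combination e4)
  simp only [Matrix.zero_apply]
  linear_combination (e1 + e3 - e2 - e5) / 2

/-- The uniform mixture of the states `aa* ⊗ (projection orthogonal to M a)`. -/
def edgeState {d : ℕ} (M : Matrix (Fin d) (Fin d) ℂ) :
    Matrix (Fin d × Fin d) (Fin d × Fin d) ℂ :=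
  ∑ p : Fin d × Fin d × Bool, (((Fintype.card (Fin d × Fin d × Bool) : ℝ)⁻¹ : ℝ) : ℂ) •
    (lineProj (testVec p) ⊗ₖ orthState (M *ᵥ testVec p))

lemma mulVec_testVec_ne_zero {d : ℕ} {M : Matrix (Fin d) (Fin d) ℂ} (hM : IsUnit M)
    (p : Fin d × Fin d × Bool) : M *ᵥ testVec p ≠ 0 := by
  intro h
  exact testVec_ne_zero p (mulVec_injective_iff_isUnit.2 hM (by simpa using h))

lemma isSep_edgeState {d : ℕ} (hd : 2 ≤ d) {M : Matrix (Fin d) (Fin d) ℂ} (hM : IsUnit M) :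
    IsSep (edgeState M) := by
  have : Nonempty (Fin d) := ⟨⟨0, by omega⟩⟩
  let e := (Fintype.equivFin (Fin d × Fin d × Bool)).symm
  refine ⟨Fintype.card (Fin d × Fin d × Bool), fun _ => (Fintype.card (Fin d × Fin d × Bool) : ℝ)⁻¹,
    fun i => lineProj (testVec (e i)), fun i => orthState (M *ᵥ testVec (e i)),
    fun _ => by positivity, ?_, fun i => isState_lineProj (testVec_ne_zero _),
    fun i => isState_orthState hd (mulVec_testVec_ne_zero hM _), ?_⟩
  · rw [Finset.sum_const, Finset.card_univ, Fintype.card_fin, nsmul_eq_mul, mul_inv_cancel₀]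
    exact_mod_cast Fintype.card_ne_zero
  · rw [edgeState, ← e.sum_comp]

lemma partialTranspose_edgeState_mulVec_vec {d : ℕ} {M : Matrix (Fin d) (Fin d) ℂ}
    (hM : IsUnit M) : partialTranspose (edgeState M) *ᵥ vec M = 0 := by
  rw [edgeState, partialTranspose_sum, sum_mulVec]
  refine Finset.sum_eq_zero fun p _ => ?_
  rw [partialTranspose_smul, partialTranspose_kronecker, smul_mulVec, kronecker_mulVec_vec,
    transpose_transpose, Matrix.mul_assoc, lineProj, mul_smul_comm, mul_vecMulVec, mul_smul_comm,
    mul_vecMulVec, orthState_mulVec_self (mulVec_testVec_ne_zero hM p)]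
  simp

lemma IsSep.isState {d : ℕ} {ρ : Matrix (Fin d × Fin d) (Fin d × Fin d) ℂ} (h : IsSep ρ) :
    IsState ρ := by
  obtain ⟨n, c, σ, η, hc, hc1, hσ, hη, rfl⟩ := h
  refine ⟨posSemidef_sum _ fun i _ =>
    ((hσ i).1.kronecker (hη i).1).smul (by exact_mod_cast hc i), ?_⟩
  simp only [trace_sum, trace_smul, trace_kronecker, (hσ _).2, (hη _).2, mul_one, smul_eq_mul]
  exact_mod_cast hc1

lemma posDef_edgeState {d : ℕ} (hd : 2 ≤ d) {M : Matrix (Fin d) (Fin d) ℂ} (hM : IsUnit M) :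
    (edgeState M).PosDef := by
  have hps := (isSep_edgeState hd hM).isState.1
  have : Nonempty (Fin d) := ⟨⟨0, by omega⟩⟩
  refine .of_dotProduct_mulVec_pos hps.isHermitian fun x hx => ?_
  refine lt_of_le_of_ne (hps.dotProduct_mulVec_nonneg x) fun h0 => hx ?_
  obtain ⟨X, rfl⟩ : ∃ X : Matrix (Fin d) (Fin d) ℂ, vec X = x :=
    ⟨of fun i j => x (j, i), rfl⟩
  have hcard : (0 : ℂ) < (((Fintype.card (Fin d × Fin d × Bool) : ℝ)⁻¹ : ℝ) : ℂ) := by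
    have : (0 : ℝ) < (Fintype.card (Fin d × Fin d × Bool) : ℝ)⁻¹ :=
      inv_pos.2 (by exact_mod_cast Fintype.card_pos)
    exact_mod_cast this
  have hterm : ∀ p, (lineProj (testVec p) ⊗ₖ orthState (M *ᵥ testVec p)).PosSemidef := fun p =>
    (lineProj_posSemidef _).kronecker (isState_orthState hd (mulVec_testVec_ne_zero hM p)).1
  rw [edgeState, sum_mulVec, dotProduct_sum, eq_comm,
    Finset.sum_eq_zero_iff_of_nonneg fun p _ =>
      ((hterm p).smul hcard.le).dotProduct_mulVec_nonneg _] at h0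
  have hX : M⁻¹ * X = 0 := by
    refine eq_zero_of_mulVec_star_testVec hd fun p => ?_
    have h1 := h0 p (Finset.mem_univ p)
    rw [((hterm p).smul hcard.le).dotProduct_mulVec_zero_iff, smul_mulVec, smul_eq_zero,
      kronecker_mulVec_vec] at h1
    have h2 := h1.resolve_left hcard.ne'
    rw [vec_eq_zero_iff] at h2
    have ha : star (testVec p) ⬝ᵥ testVec p ≠ 0 := by simpa using testVec_ne_zero p
    have h3 : (lineProj (testVec p))ᵀ *ᵥ star (testVec p) = star (testVec p) := by
      rw [lineProj, transpose_smul, transpose_vecMulVec, smul_mulVec, vecMulVec_mulVec]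
      ext i
      simp [dotProduct_comm (testVec p), field]
    have h4 : orthState (M *ᵥ testVec p) *ᵥ (X *ᵥ star (testVec p)) = 0 := by
      rw [← h3, mulVec_mulVec, mulVec_mulVec, h2, zero_mulVec]
    obtain ⟨c, hc⟩ := exists_eq_smul_of_orthState_mulVec_eq_zero hd h4
    refine ⟨c, ?_⟩
    rw [← mulVec_mulVec, hc, mulVec_smul, mulVec_mulVec,
      nonsing_inv_mul _ ((isUnit_iff_isUnit_det _).1 hM), one_mulVec]
  have : X = 0 := by
    rw [← Matrix.mul_nonsing_inv_cancel_left M X ((isUnit_iff_isUnit_det _).1 hM), hX]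
    simp
  simp [this]

theorem stmt8 (d : ℕ) (hd : 2 ≤ d)
    (Δ : Matrix (Fin d × Fin d) (Fin d × Fin d) ℂ)
    (hΔ0 : Δ ≠ 0) (hΔH : Δ.IsHermitian) (hΔtr : Δ.trace = 0) :
    ∃ (ρ : Matrix (Fin d × Fin d) (Fin d × Fin d) ℂ) (lam : ℝ),
      IsSep ρ ∧ IsState (ρ + (lam : ℂ) • Δ) ∧ ¬ IsSep (ρ + (lam : ℂ) • Δ) := by
  obtain ⟨M, hM, hq⟩ := exists_isUnit_quadForm_vec_ne_zero (partialTranspose_isHermitian hΔH)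
    (partialTranspose_ne_zero hΔ0)
  have hsep := isSep_edgeState hd hM
  obtain ⟨ε, hε, hpos, hneg⟩ := exists_pos_perturb_posSemidef (posDef_edgeState hd hM) hΔH
  have htr : ∀ t : ℝ, (edgeState M + (t : ℂ) • Δ).trace = 1 := fun t => by
    rw [trace_add, trace_smul, hΔtr, smul_zero, add_zero, hsep.isState.2]
  have key : ∀ t : ℝ, IsSep (edgeState M + (t : ℂ) • Δ) →
      0 ≤ (t : ℂ) * (star (vec M) ⬝ᵥ (partialTranspose Δ *ᵥ vec M)) := fun t ht => by
    have := ht.posSemidef_partialTranspose.dotProduct_mulVec_nonneg (vec M)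
    rwa [partialTranspose_add, partialTranspose_smul, add_mulVec,
      partialTranspose_edgeState_mulVec_vec hM, zero_add, smul_mulVec, dotProduct_smul,
      smul_eq_mul] at this
  have hε' : (0 : ℂ) < ε := by exact_mod_cast hε
  by_cases h1 : IsSep (edgeState M + (ε : ℂ) • Δ)
  · refine ⟨edgeState M, -ε, hsep, ⟨hneg, htr _⟩, fun h2 => hq ?_⟩
    have k1 := key _ h1
    have k2 := key _ h2
    push_cast at k2
    rw [neg_mul, Left.nonneg_neg_iff] at k2
    exact (mul_eq_zero.1 (le_antisymm k2 k1)).resolve_left hε'.ne'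
  · exact ⟨edgeState M, ε, hsep, ⟨hpos, htr _⟩, h1⟩
end
end

section
/- Let d ≥ 2 and let (E_1, ..., E_n) be a POVM on C^d ⊗ C^d with the property that for every classical-classical state ρ and every state σ that is not classical-classical there exists an index j with tr(ρE_j) ≠ tr(σE_j). Then (E_1, ..., E_n) is informationally complete, i.e., any two states ρ, σ on C^d ⊗ C^d satisfying tr(ρE_j) = tr(σE_j) for all j are equal. -/
open Matrix
open Kronecker
open scoped ComplexOrder

noncomputable section

/-- Real-diagonalizability in a product orthonormal basis. -/
def IsProductDiagonal {d : ℕ} (M : Matrix (Fin d × Fin d) (Fin d × Fin d) ℂ) : Prop :=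
  ∃ U ∈ unitaryGroup (Fin d) ℂ, ∃ V ∈ unitaryGroup (Fin d) ℂ, ∃ c : Fin d × Fin d → ℝ,
    M = (U ⊗ₖ V) * diagonal (fun p => (c p : ℂ)) * (U ⊗ₖ V)ᴴ

lemma conjTranspose_mul_self_of_mem_unitaryGroup {m : Type*} [Fintype m] [DecidableEq m]
    {U : Matrix m m ℂ} (hU : U ∈ unitaryGroup m ℂ) : Uᴴ * U = 1 :=
  mem_unitaryGroup_iff'.mp hU

lemma mul_conjTranspose_self_of_mem_unitaryGroup {m : Type*} [Fintype m] [DecidableEq m]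
    {U : Matrix m m ℂ} (hU : U ∈ unitaryGroup m ℂ) : U * Uᴴ = 1 :=
  mem_unitaryGroup_iff.mp hU

lemma kronecker_mem_unitaryGroup {m : Type*} [Fintype m] [DecidableEq m]
    {U V : Matrix m m ℂ} (hU : U ∈ unitaryGroup m ℂ) (hV : V ∈ unitaryGroup m ℂ) :
    U ⊗ₖ V ∈ unitaryGroup (m × m) ℂ :=
  kronecker_mem_unitary hU hV

lemma IsONB.transpose_mem_unitaryGroup {d : ℕ} {φ : Fin d → Fin d → ℂ} (hφ : IsONB φ) :
    (Matrix.of φ)ᵀ ∈ unitaryGroup (Fin d) ℂ := by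
  rw [mem_unitaryGroup_iff']
  ext i j
  simpa [mul_apply, dotProduct, one_apply] using hφ i j

lemma isONB_of_mem_unitaryGroup {d : ℕ} {U : Matrix (Fin d) (Fin d) ℂ}
    (hU : U ∈ unitaryGroup (Fin d) ℂ) : IsONB (fun i a => U a i) := by
  intro i j
  have h := congrFun (congrFun (conjTranspose_mul_self_of_mem_unitaryGroup hU) i) j
  simpa [mul_apply, dotProduct, one_apply] using h

lemma mul_diagonal_mul_conjTranspose_apply {l m : Type*} [Fintype m] [DecidableEq m]
    (W : Matrix l m ℂ) (c : m → ℂ) (p q : l) :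
    (W * diagonal c * Wᴴ) p q = ∑ r, W p r * c r * star (W q r) := by
  rw [mul_apply]
  simp only [mul_diagonal, conjTranspose_apply]

lemma kronecker_mul_diagonal_mul_conjTranspose {d : ℕ} (U V : Matrix (Fin d) (Fin d) ℂ)
    (c : Fin d × Fin d → ℂ) :
    (U ⊗ₖ V) * diagonal c * (U ⊗ₖ V)ᴴ =
      ∑ i, ∑ j, c (i, j) • (vecMulVec (fun a => U a i) (star fun a => U a i) ⊗ₖ
        vecMulVec (fun b => V b j) (star fun b => V b j)) := by
  ext ⟨a, b⟩ ⟨a', b'⟩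
  simp only [mul_diagonal_mul_conjTranspose_apply, Fintype.sum_prod_type, Matrix.sum_apply,
    Matrix.smul_apply, kroneckerMap_apply, vecMulVec_apply, Pi.star_apply, smul_eq_mul, star_mul']
  refine Finset.sum_congr rfl fun i _ => Finset.sum_congr rfl fun j _ => ?_
  ring

lemma IsCC.isProductDiagonal {d : ℕ} {M : Matrix (Fin d × Fin d) (Fin d × Fin d) ℂ}
    (h : IsCC M) : IsProductDiagonal M := by
  obtain ⟨φ, χ, c, hφ, hχ, -, -, rfl⟩ := h
  refine ⟨_, hφ.transpose_mem_unitaryGroup, _, hχ.transpose_mem_unitaryGroup,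
    fun p => c p.1 p.2, ?_⟩
  rw [kronecker_mul_diagonal_mul_conjTranspose]
  rfl

lemma IsProductDiagonal.isCC {d : ℕ} {M : Matrix (Fin d × Fin d) (Fin d × Fin d) ℂ}
    (h : IsProductDiagonal M) (hM : IsState M) : IsCC M := by
  obtain ⟨U, hU, V, hV, c, rfl⟩ := h
  have hW := conjTranspose_mul_self_of_mem_unitaryGroup (kronecker_mem_unitaryGroup hU hV)
  refine ⟨fun i a => U a i, fun i a => V a i, fun i j => c (i, j), isONB_of_mem_unitaryGroup hU,
    isONB_of_mem_unitaryGroup hV, fun i j => ?_, ?_,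
    kronecker_mul_diagonal_mul_conjTranspose U V _⟩
  · have h := hM.1.conjTranspose_mul_mul_same (U ⊗ₖ V)
    rw [Matrix.mul_assoc, Matrix.mul_assoc, hW, Matrix.mul_one, ← Matrix.mul_assoc, hW,
      Matrix.one_mul, posSemidef_diagonal_iff] at h
    exact_mod_cast h (i, j)
  · have h := hM.2
    rw [trace_mul_comm, ← Matrix.mul_assoc, hW, Matrix.one_mul, trace_diagonal,
      Fintype.sum_prod_type] at h
    exact_mod_cast h

lemma IsProductDiagonal.smul {d : ℕ} {M : Matrix (Fin d × Fin d) (Fin d × Fin d) ℂ}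
    (h : IsProductDiagonal M) (r : ℝ) : IsProductDiagonal ((r : ℂ) • M) := by
  obtain ⟨U, hU, V, hV, c, rfl⟩ := h
  refine ⟨U, hU, V, hV, fun p => r * c p, ?_⟩
  rw [← Matrix.smul_mul, ← Matrix.mul_smul, ← diagonal_smul]
  congr 3
  ext p
  simp

lemma IsProductDiagonal.add_smul_one {d : ℕ} {M : Matrix (Fin d × Fin d) (Fin d × Fin d) ℂ}
    (h : IsProductDiagonal M) (r : ℝ) : IsProductDiagonal (M + (r : ℂ) • 1) := by
  obtain ⟨U, hU, V, hV, c, rfl⟩ := h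
  refine ⟨U, hU, V, hV, fun p => c p + r, ?_⟩
  rw [← mul_conjTranspose_self_of_mem_unitaryGroup (kronecker_mem_unitaryGroup hU hV)]
  have : diagonal (fun p => ((c p + r : ℝ) : ℂ)) =
      diagonal (fun p => (c p : ℂ)) + (r : ℂ) • (1 : Matrix (Fin d × Fin d) _ ℂ) := by
    rw [smul_one_eq_diagonal, diagonal_add]
    simp
  rw [this, Matrix.mul_add, Matrix.add_mul, Matrix.mul_smul, Matrix.mul_one, Matrix.smul_mul]

lemma IsProductDiagonal.conj {d : ℕ} {M : Matrix (Fin d × Fin d) (Fin d × Fin d) ℂ}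
    (h : IsProductDiagonal M) {A B : Matrix (Fin d) (Fin d) ℂ}
    (hA : A ∈ unitaryGroup (Fin d) ℂ) (hB : B ∈ unitaryGroup (Fin d) ℂ) :
    IsProductDiagonal ((A ⊗ₖ B) * M * (A ⊗ₖ B)ᴴ) := by
  obtain ⟨U, hU, V, hV, c, rfl⟩ := h
  refine ⟨A * U, mul_mem hA hU, B * V, mul_mem hB hV, c, ?_⟩
  rw [mul_kronecker_mul, conjTranspose_mul]
  simp only [Matrix.mul_assoc]

lemma isProductDiagonal_kronecker {d : ℕ} {H K : Matrix (Fin d) (Fin d) ℂ}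
    (hH : H.IsHermitian) (hK : K.IsHermitian) : IsProductDiagonal (H ⊗ₖ K) := by
  refine ⟨_, hH.eigenvectorUnitary.2, _, hK.eigenvectorUnitary.2,
    fun p => hH.eigenvalues p.1 * hK.eigenvalues p.2, ?_⟩
  conv_lhs => rw [hH.spectral_theorem, hK.spectral_theorem]
  rw [Unitary.conjStarAlgAut_apply, Unitary.conjStarAlgAut_apply, mul_kronecker_mul,
    mul_kronecker_mul, diagonal_kronecker_diagonal, conjTranspose_kronecker]
  simp [star_eq_conjTranspose]

lemma IsProductDiagonal.commute_blocks_left {d : ℕ}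
    {M : Matrix (Fin d × Fin d) (Fin d × Fin d) ℂ} (h : IsProductDiagonal M) (j k : Fin d) :
    Commute (M.submatrix (·, j) (·, j)) (M.submatrix (·, k) (·, k)) := by
  obtain ⟨U, hU, V, hV, c, rfl⟩ := h
  have key : ∀ j, ((U ⊗ₖ V) * diagonal (fun p => (c p : ℂ)) * (U ⊗ₖ V)ᴴ).submatrix (·, j) (·, j) =
      U * diagonal (fun i => ∑ l, V j l * c (i, l) * star (V j l)) * Uᴴ := by
    intro j
    ext a a'
    simp only [submatrix_apply, mul_diagonal_mul_conjTranspose_apply, Fintype.sum_prod_type,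
      kroneckerMap_apply, star_mul', Finset.mul_sum, Finset.sum_mul]
    refine Finset.sum_congr rfl fun i _ => Finset.sum_congr rfl fun l _ => ?_
    ring
  have hUU := conjTranspose_mul_self_of_mem_unitaryGroup hU
  rw [key, key]
  generalize (fun i => ∑ l, V j l * c (i, l) * star (V j l)) = x
  generalize (fun i => ∑ l, V k l * c (i, l) * star (V k l)) = y
  have aux : ∀ x y : Fin d → ℂ, (U * diagonal x * Uᴴ) * (U * diagonal y * Uᴴ) =
      U * diagonal (fun i => x i * y i) * Uᴴ := by
    intro x y
    rw [← diagonal_mul_diagonal]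
    calc _ = U * diagonal x * (Uᴴ * U) * diagonal y * Uᴴ := by simp only [Matrix.mul_assoc]
      _ = _ := by rw [hUU, Matrix.mul_one]; simp only [Matrix.mul_assoc]
  rw [commute_iff_eq, aux, aux]
  simp only [mul_comm]

lemma IsProductDiagonal.swap {d : ℕ} {M : Matrix (Fin d × Fin d) (Fin d × Fin d) ℂ}
    (h : IsProductDiagonal M) : IsProductDiagonal (M.submatrix Prod.swap Prod.swap) := by
  obtain ⟨U, hU, V, hV, c, rfl⟩ := h
  refine ⟨V, hV, U, hU, c ∘ Prod.swap, ?_⟩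
  ext ⟨a, b⟩ ⟨a', b'⟩
  simp only [submatrix_apply, mul_diagonal_mul_conjTranspose_apply, Fintype.sum_prod_type,
    Prod.swap, kroneckerMap_apply, star_mul', Function.comp_apply]
  rw [Finset.sum_comm]
  refine Finset.sum_congr rfl fun i _ => Finset.sum_congr rfl fun l _ => ?_
  ring

/-- The perturbation is the all-ones matrix on the first factor, supported at one basis vector
of the second. -/
lemma eq_of_isProductDiagonal_perturbation {d : ℕ} {x : Fin d × Fin d → ℂ} {j k : Fin d}
    (hjk : k ≠ j)
    (h : IsProductDiagonal (1 + vecMulVec 1 1 ⊗ₖ diagonal (Pi.single k 1) + diagonal x))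
    (a a' : Fin d) : x (a, j) = x (a', j) := by
  by_cases haa : a = a'
  · rw [haa]
  have hc := h.commute_blocks_left k j
  have hk : (1 + vecMulVec 1 1 ⊗ₖ diagonal (Pi.single k 1) + diagonal x).submatrix (·, k) (·, k) =
      vecMulVec 1 1 + diagonal (fun i => 1 + x (i, k)) := by
    ext i i'
    by_cases hi : i = i' <;> simp [hi, one_apply]
    ring
  have hj : (1 + vecMulVec 1 1 ⊗ₖ diagonal (Pi.single k 1) + diagonal x).submatrix (·, j) (·, j) =
      diagonal (fun i => 1 + x (i, j)) := by
    ext i i'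
    by_cases hi : i = i' <;> simp [hi, one_apply, hjk.symm]
  rw [hk, hj] at hc
  have := congrFun (congrFun hc.eq a) a'
  simp [mul_diagonal, diagonal_mul, haa] at this
  exact this.symm

lemma IsState.posSemidef_one_sub {m : Type*} [Fintype m] [DecidableEq m] {σ : Matrix m m ℂ}
    (h : IsState σ) : (1 - σ).PosSemidef := by
  have hH := h.1.isHermitian
  have hs : ∑ i, hH.eigenvalues i = 1 := by
    have := hH.trace_eq_sum_eigenvalues
    rw [h.2] at this
    exact (RCLike.ofReal_inj (K := ℂ)).mp (by simpa using this.symm)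
  have hle : ∀ i, hH.eigenvalues i ≤ 1 := fun i => hs ▸
    Finset.single_le_sum (fun j _ => h.1.eigenvalues_nonneg j) (Finset.mem_univ i)
  have : 1 - σ = (hH.eigenvectorUnitary : Matrix m m ℂ) *
      diagonal (fun i => ((1 - hH.eigenvalues i : ℝ) : ℂ)) *
      (hH.eigenvectorUnitary : Matrix m m ℂ)ᴴ := by
    have hd : diagonal (fun i => ((1 - hH.eigenvalues i : ℝ) : ℂ)) =
        (1 : Matrix m m ℂ) - diagonal (RCLike.ofReal ∘ hH.eigenvalues) := by
      rw [← diagonal_one, diagonal_sub]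
      simp
    conv_lhs => rw [hH.spectral_theorem, Unitary.conjStarAlgAut_apply]
    rw [hd, Matrix.mul_sub, Matrix.sub_mul, Matrix.mul_one,
      mul_conjTranspose_self_of_mem_unitaryGroup hH.eigenvectorUnitary.2]
    rfl
  rw [this]
  refine PosSemidef.mul_mul_conjTranspose_same (posSemidef_diagonal_iff.mpr fun i => ?_) _
  exact_mod_cast sub_nonneg.mpr (hle i)

theorem stmt12 (d n : ℕ) (hd : 2 ≤ d)
    (E : Fin n → Matrix (Fin d × Fin d) (Fin d × Fin d) ℂ)
    (hEpos : ∀ j, (E j).PosSemidef) (hEsum : (∑ j, E j) = 1)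
    (hdetect : ∀ ρ σ : Matrix (Fin d × Fin d) (Fin d × Fin d) ℂ,
      IsCC ρ → IsState σ → ¬ IsCC σ → ∃ j, (ρ * E j).trace ≠ (σ * E j).trace) :
    ∀ ρ σ : Matrix (Fin d × Fin d) (Fin d × Fin d) ℂ,
      IsState ρ → IsState σ → (∀ j, (ρ * E j).trace = (σ * E j).trace) → ρ = σ := by
  intro ρ σ hρ hσ hE
  have hne : Nonempty (Fin d) := ⟨⟨0, by omega⟩⟩
  have key : ∀ N : Matrix (Fin d × Fin d) (Fin d × Fin d) ℂ, N.PosSemidef →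
      IsProductDiagonal N → IsProductDiagonal (1 + N + (ρ - σ)) := by
    intro N hN hNd
    have hNd' : IsProductDiagonal (1 + N) := by
      simpa [add_comm] using hNd.add_smul_one 1
    obtain ⟨T, hT, hTr⟩ : ∃ T : ℝ, 0 < T ∧ (1 + N).trace = T := by
      have hpos : (0 : ℂ) < (1 + N).trace := by
        rw [trace_add, trace_one]
        exact add_pos_of_pos_of_nonneg (Nat.cast_pos.mpr Fintype.card_pos) hN.trace_nonneg
      obtain ⟨hre, him⟩ := Complex.pos_iff.mp hpos
      exact ⟨_, hre, Complex.ext rfl him.symm⟩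
    have hT' : (T : ℂ) ≠ 0 := by exact_mod_cast hT.ne'
    have hTi : (0 : ℂ) ≤ ((T⁻¹ : ℝ) : ℂ) := by exact_mod_cast (inv_pos.mpr hT).le
    have hs₁ : IsState (((T⁻¹ : ℝ) : ℂ) • (1 + N)) := by
      refine ⟨(PosSemidef.one.add hN).smul hTi, ?_⟩
      rw [trace_smul, hTr, smul_eq_mul, Complex.ofReal_inv, inv_mul_cancel₀ hT']
    have hs₂ : IsState (((T⁻¹ : ℝ) : ℂ) • (1 + N + (ρ - σ))) := by
      refine ⟨PosSemidef.smul ?_ hTi, ?_⟩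
      · have : 1 + N + (ρ - σ) = (1 - σ) + N + ρ := by abel
        rw [this]
        exact (hσ.posSemidef_one_sub.add hN).add hρ.1
      · rw [trace_smul, trace_add, trace_sub, hρ.2, hσ.2, hTr, sub_self, add_zero, smul_eq_mul,
          Complex.ofReal_inv, inv_mul_cancel₀ hT']
    have hcc : IsCC (((T⁻¹ : ℝ) : ℂ) • (1 + N + (ρ - σ))) := by
      by_contra hcc
      obtain ⟨j, hj⟩ := hdetect _ _ ((hNd'.smul T⁻¹).isCC hs₁) hs₂ hcc
      apply hj
      simp only [Matrix.smul_mul, trace_smul, Matrix.add_mul (_ + _), Matrix.sub_mul, trace_add,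
        trace_sub, hE j, sub_self, add_zero]
    have := hcc.isProductDiagonal.smul T
    rwa [smul_smul, Complex.ofReal_inv, mul_inv_cancel₀ hT', one_smul] at this
  have h0 : IsProductDiagonal (ρ - σ) := by
    have hz : IsProductDiagonal (0 : Matrix (Fin d × Fin d) (Fin d × Fin d) ℂ) := by
      simpa using isProductDiagonal_kronecker (isHermitian_zero (n := Fin d) (α := ℂ))
        (isHermitian_zero (n := Fin d) (α := ℂ))
    have := (key 0 PosSemidef.zero hz).add_smul_one (-1)
    simpa using this
  obtain ⟨U, hU, V, hV, c, hc⟩ := h0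
  have hW := kronecker_mem_unitaryGroup hU hV
  have hW₁ := conjTranspose_mul_self_of_mem_unitaryGroup hW
  set x : Fin d × Fin d → ℂ := fun p => (c p : ℂ) with hx
  have key' : ∀ H K : Matrix (Fin d) (Fin d) ℂ, H.PosSemidef → K.PosSemidef →
      IsProductDiagonal (1 + H ⊗ₖ K + diagonal x) := by
    intro H K hH hK
    have h := (key _ ((hH.kronecker hK).mul_mul_conjTranspose_same (U ⊗ₖ V))
      ((isProductDiagonal_kronecker hH.isHermitian hK.isHermitian).conj hU hV)).conj
      (Unitary.star_mem hU) (Unitary.star_mem hV)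
    have hs : star U ⊗ₖ star V = (U ⊗ₖ V)ᴴ := (conjTranspose_kronecker U V).symm
    have hcan : ∀ A, (U ⊗ₖ V)ᴴ * ((U ⊗ₖ V) * A * (U ⊗ₖ V)ᴴ) * (U ⊗ₖ V) = A := by
      intro A
      rw [← Matrix.mul_assoc, ← Matrix.mul_assoc, hW₁, Matrix.one_mul, Matrix.mul_assoc, hW₁,
        Matrix.mul_one]
    rwa [hc, hs, conjTranspose_conjTranspose, Matrix.mul_add, Matrix.mul_add, Matrix.add_mul,
      Matrix.add_mul, hcan, hcan, Matrix.mul_one, hW₁] at h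
  have hJ : (vecMulVec 1 1 : Matrix (Fin d) (Fin d) ℂ).PosSemidef := by
    simpa using posSemidef_vecMulVec_self_star (1 : Fin d → ℂ)
  have hP : ∀ k : Fin d, (diagonal (Pi.single k 1) : Matrix (Fin d) (Fin d) ℂ).PosSemidef := by
    intro k
    rw [posSemidef_diagonal_iff]
    intro i
    by_cases hik : i = k
    · subst hik; simp
    · simp [hik]
  have : Nontrivial (Fin d) := Fin.nontrivial_iff_two_le.mpr hd
  have hleft : ∀ a a' j, x (a, j) = x (a', j) := by
    intro a a' j
    obtain ⟨k, hk⟩ := exists_ne j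
    exact eq_of_isProductDiagonal_perturbation hk (key' _ _ hJ (hP k)) a a'
  have hright : ∀ i b b', x (i, b) = x (i, b') := by
    intro i b b'
    obtain ⟨k, hk⟩ := exists_ne i
    have h := (key' _ _ (hP k) hJ).swap
    have hsw : (1 + diagonal (Pi.single k 1) ⊗ₖ vecMulVec 1 1 + diagonal x).submatrix
        Prod.swap Prod.swap =
        1 + vecMulVec 1 1 ⊗ₖ diagonal (Pi.single k 1) + diagonal (x ∘ Prod.swap) := by
      ext ⟨a, b⟩ ⟨a', b'⟩
      simp [one_apply, diagonal_apply, and_comm, mul_comm]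
    rw [hsw] at h
    exact eq_of_isProductDiagonal_perturbation hk h b b'
  obtain ⟨o⟩ := hne
  have hconst : ∀ p, x p = x (o, o) := fun ⟨i, j⟩ => (hleft i o j).trans (hright o j o)
  have htr : (diagonal x).trace = 0 := by
    have : (ρ - σ).trace = 0 := by rw [trace_sub, hρ.2, hσ.2, sub_self]
    rwa [hc, trace_mul_comm, ← Matrix.mul_assoc, hW₁, Matrix.one_mul] at this
  have hx0 : x (o, o) = 0 := by
    rw [trace_diagonal, Finset.sum_congr rfl fun p _ => hconst p] at htr
    simpa [show d ≠ 0 by omega] using htr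
  have : diagonal x = 0 := by
    rw [← diagonal_zero]
    exact congrArg _ (funext fun p => (hconst p).trans hx0)
  rw [this, Matrix.mul_zero, Matrix.zero_mul] at hc
  exact sub_eq_zero.mp hc
end
end

section
/- Let d ≥ 2 and let (E_1, ..., E_n) be a POVM on C^d ⊗ C^d with the property that for every state ρ that is classical-quantum or quantum-classical and every state σ that is neither classical-quantum nor quantum-classical there exists an index j with tr(ρE_j) ≠ tr(σE_j). Then (E_1, ..., E_n) is informationally complete, i.e., any two states ρ, σ on C^d ⊗ C^d satisfying tr(ρE_j) = tr(σE_j) for all j are equal. -/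
open Matrix
open Kronecker
open scoped ComplexOrder

noncomputable section

/-- The partial contraction `A ⊗ B ↦ tr(F B) A` against a matrix `F` on the second factor. -/
def partialContraction {m n : Type*} [Fintype n] (F : Matrix n n ℂ) :
    Matrix (m × n) (m × n) ℂ →ₗ[ℂ] Matrix m m ℂ where
  toFun ρ := of fun a b => ∑ l, ∑ k, F l k * ρ (a, k) (b, l)
  map_add' ρ σ := by
    ext a b
    simp [mul_add, Finset.sum_add_distrib]
  map_smul' c ρ := by
    ext a b
    simp [Finset.mul_sum, mul_left_comm]

theorem partialContraction_kronecker {m n : Type*} [Fintype n] (F : Matrix n n ℂ)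
    (A : Matrix m m ℂ) (B : Matrix n n ℂ) :
    partialContraction F (A ⊗ₖ B) = (F * B).trace • A := by
  ext a b
  simp [partialContraction, Matrix.trace, Matrix.mul_apply, Finset.sum_mul, mul_assoc,
    mul_comm (A a b)]

theorem partialContraction_one {m n : Type*} [Fintype n] [DecidableEq m] [DecidableEq n]
    (F : Matrix n n ℂ) :
    partialContraction F (1 : Matrix (m × n) (m × n) ℂ) = F.trace • 1 := by
  rw [← one_kronecker_one, partialContraction_kronecker, mul_one]

/-- Exchange of the two tensor factors. -/
def swapFactors {m : Type*} :
    Matrix (m × m) (m × m) ℂ →ₗ[ℂ] Matrix (m × m) (m × m) ℂ where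
  toFun ρ := ρ.submatrix Prod.swap Prod.swap
  map_add' _ _ := rfl
  map_smul' _ _ := rfl

@[simp]
theorem swapFactors_apply {m : Type*} (ρ : Matrix (m × m) (m × m) ℂ) (p q : m × m) :
    swapFactors ρ p q = ρ p.swap q.swap := rfl

@[simp]
theorem swapFactors_swapFactors {m : Type*} (ρ : Matrix (m × m) (m × m) ℂ) :
    swapFactors (swapFactors ρ) = ρ := rfl

theorem swapFactors_kronecker {m : Type*} (A B : Matrix m m ℂ) :
    swapFactors (A ⊗ₖ B) = B ⊗ₖ A := by
  ext p q
  simp [mul_comm]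

theorem swapFactors_one {m : Type*} [DecidableEq m] :
    swapFactors (1 : Matrix (m × m) (m × m) ℂ) = 1 :=
  submatrix_one_equiv (Equiv.prodComm m m)

theorem trace_swapFactors {m : Type*} [Fintype m] (ρ : Matrix (m × m) (m × m) ℂ) :
    (swapFactors ρ).trace = ρ.trace :=
  (Equiv.prodComm m m).sum_comp fun p => ρ p p

theorem IsCQ.swapFactors {d : ℕ} {ρ : Matrix (Fin d × Fin d) (Fin d × Fin d) ℂ}
    (h : IsCQ ρ) : IsQC (swapFactors ρ) := by
  obtain ⟨φ, c, η, hφ, hc, hs, hη, rfl⟩ := h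
  exact ⟨φ, c, η, hφ, hc, hs, hη, by simp [-swapFactors_apply, swapFactors_kronecker]⟩

theorem IsQC.swapFactors {d : ℕ} {ρ : Matrix (Fin d × Fin d) (Fin d × Fin d) ℂ}
    (h : IsQC ρ) : IsCQ (swapFactors ρ) := by
  obtain ⟨φ, c, η, hφ, hc, hs, hη, rfl⟩ := h
  exact ⟨φ, c, η, hφ, hc, hs, hη, by simp [-swapFactors_apply, swapFactors_kronecker]⟩

theorem IsState.swapFactors {m : Type*} [Fintype m] {ρ : Matrix (m × m) (m × m) ℂ}
    (h : IsState ρ) : IsState (swapFactors ρ) :=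
  ⟨h.1.submatrix _, (trace_swapFactors ρ).trans h.2⟩

theorem IsONB.commute_projections {d : ℕ} {φ : Fin d → Fin d → ℂ} (h : IsONB φ) (i j : Fin d) :
    Commute (vecMulVec (φ i) (star (φ i))) (vecMulVec (φ j) (star (φ j))) := by
  by_cases hij : i = j
  · rw [hij]
  · simp [Commute, SemiconjBy, vecMulVec_mul_vecMulVec, h i j, h j i, hij, Ne.symm hij]

/-- All partial contractions of a classical-quantum state are diagonal in a common basis. -/
theorem IsCQ.commute_partialContraction {d : ℕ} {ρ : Matrix (Fin d × Fin d) (Fin d × Fin d) ℂ}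
    (h : IsCQ ρ) (F G : Matrix (Fin d) (Fin d) ℂ) :
    Commute (partialContraction F ρ) (partialContraction G ρ) := by
  obtain ⟨φ, c, η, hφ, -, -, -, rfl⟩ := h
  simp only [map_sum, map_smul, partialContraction_kronecker]
  refine Commute.sum_left _ _ _ fun i _ => Commute.sum_right _ _ _ fun j _ => ?_
  exact ((((hφ.commute_projections i j).smul_left _).smul_left _).smul_right _).smul_right _

theorem Matrix.IsHermitian.exists_spectral_decomposition {d : ℕ} {B : Matrix (Fin d) (Fin d) ℂ}
    (hB : B.IsHermitian) :
    ∃ (χ : Fin d → Fin d → ℂ) (b : Fin d → ℝ), IsONB χ ∧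
      (∑ i, vecMulVec (χ i) (star (χ i))) = 1 ∧
      (∑ i, (b i : ℂ) • vecMulVec (χ i) (star (χ i))) = B := by
  obtain ⟨U, hU⟩ : ∃ U : Matrix (Fin d) (Fin d) ℂ, U = hB.eigenvectorUnitary := ⟨_, rfl⟩
  have h1 : Uᴴ * U = 1 := by rw [hU]; exact Unitary.coe_star_mul_self _
  have h2 : U * Uᴴ = 1 := by rw [hU]; exact Unitary.coe_mul_star_self _
  have h3 : U * diagonal (fun i => (hB.eigenvalues i : ℂ)) * Uᴴ = B := by
    conv_rhs => rw [hB.spectral_theorem, Unitary.conjStarAlgAut_apply]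
    rw [hU]; rfl
  refine ⟨fun i k => U k i, hB.eigenvalues, fun i j => ?_, ?_, ?_⟩
  · simpa [Matrix.mul_apply, Matrix.one_apply, dotProduct] using congrFun₂ h1 i j
  · rw [← h2]
    ext k l
    simp [Matrix.sum_apply, vecMulVec_apply, Matrix.mul_apply]
  · conv_rhs => rw [← h3]
    ext k l
    rw [Matrix.mul_apply]
    simp only [Matrix.sum_apply, Matrix.smul_apply, vecMulVec_apply, mul_diagonal,
      conjTranspose_apply, smul_eq_mul, Pi.star_apply]
    exact Finset.sum_congr rfl fun i _ => by ring

/-- A sufficiently large multiple of the identity makes a Hermitian matrix positive definite. -/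
theorem Matrix.IsHermitian.exists_posDef_smul_one_add {n : Type*} [Fintype n] [DecidableEq n]
    {H : Matrix n n ℂ} (hH : H.IsHermitian) :
    ∃ r₀ : ℝ, ∀ r : ℝ, r₀ ≤ r → ((r : ℂ) • (1 : Matrix n n ℂ) + H).PosDef := by
  obtain ⟨U, hU⟩ : ∃ U : Matrix n n ℂ, U = hH.eigenvectorUnitary := ⟨_, rfl⟩
  have h2 : U * Uᴴ = 1 := by rw [hU]; exact Unitary.coe_mul_star_self _
  have h3 : U * diagonal (fun i => (hH.eigenvalues i : ℂ)) * Uᴴ = H := by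
    conv_rhs => rw [hH.spectral_theorem, Unitary.conjStarAlgAut_apply]
    rw [hU]; rfl
  refine ⟨∑ i, |hH.eigenvalues i| + 1, fun r hr => ?_⟩
  have key : (diagonal fun i => ((r + hH.eigenvalues i : ℝ) : ℂ)).PosDef := by
    refine PosDef.diagonal fun i => ?_
    have h := Finset.single_le_sum (f := fun i => |hH.eigenvalues i|)
      (fun i _ => abs_nonneg _) (Finset.mem_univ i)
    have := neg_abs_le (hH.eigenvalues i)
    exact_mod_cast (by linarith : (0 : ℝ) < r + hH.eigenvalues i)
  have hinj : Function.Injective U.vecMul := by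
    refine Function.LeftInverse.injective (g := Uᴴ.vecMul) fun v => ?_
    simp [vecMul_vecMul, h2]
  have hsum : (r : ℂ) • (1 : Matrix n n ℂ) + H
      = U * (diagonal fun i => ((r + hH.eigenvalues i : ℝ) : ℂ)) * Uᴴ := by
    have : (diagonal fun i => ((r + hH.eigenvalues i : ℝ) : ℂ))
        = (r : ℂ) • (1 : Matrix n n ℂ) + diagonal (fun i => (hH.eigenvalues i : ℂ)) := by
      ext i j
      by_cases hij : i = j <;> simp [hij]
    rw [this, mul_add, add_mul, h3]
    simp [h2]
  rw [hsum]
  exact key.mul_mul_conjTranspose_same hinj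

/-- A matrix commuting with all Hermitian matrices is scalar. -/
theorem Matrix.exists_eq_smul_one_of_commute_isHermitian {n : Type*} [Fintype n] [DecidableEq n]
    {M : Matrix n n ℂ} (h : ∀ B : Matrix n n ℂ, B.IsHermitian → Commute M B) :
    ∃ x : ℂ, M = x • 1 := by
  obtain ⟨x, hx⟩ := mem_range_scalar_iff_commute_single'.mpr fun i j => by
    have hR := h _ (realPart (single i j (1 : ℂ))).2
    have hI := h _ (imaginaryPart (single i j (1 : ℂ))).2
    have := hR.add_right (hI.smul_right Complex.I)
    rw [realPart_add_I_smul_imaginaryPart] at this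
    exact this.symm
  exact ⟨x, by rw [← hx, scalar_apply, ← smul_one_eq_diagonal]⟩

theorem subsingleton_setOf_add_smul_eq_zero {V : Type*} [AddCommGroup V] [Module ℂ V]
    (v : V) {w : V} (hw : w ≠ 0) : {s : ℝ | v + (s : ℂ) • w = 0}.Subsingleton := by
  intro s hs t ht
  have : ((s : ℂ) - t) • w = 0 := by
    rw [sub_smul, sub_eq_zero]
    exact add_left_cancel (hs.trans ht.symm)
  simpa [hw, sub_eq_zero] using this

theorem exists_add_smul_ne_zero_and {V W : Type*} [AddCommGroup V] [Module ℂ V]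
    [AddCommGroup W] [Module ℂ W] (v : V) {v' : V} (w : W) {w' : W} (hv : v' ≠ 0) (hw : w' ≠ 0) :
    ∃ s : ℝ, v + (s : ℂ) • v' ≠ 0 ∧ w + (s : ℂ) • w' ≠ 0 := by
  obtain ⟨s, hs⟩ := ((subsingleton_setOf_add_smul_eq_zero v hv).finite.union
    (subsingleton_setOf_add_smul_eq_zero w hw).finite).exists_notMem
  exact ⟨s, fun h => hs (Or.inl h), fun h => hs (Or.inr h)⟩

theorem trace_sum_kronecker_projections {d : ℕ} {χ : Fin d → Fin d → ℂ} (hχ : IsONB χ)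
    (A : Fin d → Matrix (Fin d) (Fin d) ℂ) :
    (∑ i, A i ⊗ₖ vecMulVec (χ i) (star (χ i))).trace = ∑ i, (A i).trace := by
  rw [trace_sum]
  refine Finset.sum_congr rfl fun i _ => ?_
  rw [trace_kronecker, trace_vecMulVec, dotProduct_comm, hχ i i, if_pos rfl, mul_one]

theorem isQC_inv_trace_smul_sum {d : ℕ} [NeZero d] {χ : Fin d → Fin d → ℂ} (hχ : IsONB χ)
    {A : Fin d → Matrix (Fin d) (Fin d) ℂ} (hA : ∀ i, (A i).PosDef) :
    IsQC ((∑ i, (A i).trace)⁻¹ • ∑ i, A i ⊗ₖ vecMulVec (χ i) (star (χ i))) := by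
  have hpos : ∀ i, 0 < (A i).trace := fun i => (hA i).trace_pos
  have hre : ∀ i, 0 < (A i).trace.re := fun i => (Complex.pos_iff.mp (hpos i)).1
  have hcoe : ∀ i, ((A i).trace.re : ℂ) = (A i).trace := fun i =>
    Complex.ext rfl (by simpa using (Complex.pos_iff.mp (hpos i)).2)
  have hsum : 0 < ∑ i, (A i).trace.re := Finset.sum_pos (fun i _ => hre i) Finset.univ_nonempty
  refine ⟨χ, fun i => (A i).trace.re / ∑ j, (A j).trace.re, fun i => (A i).trace⁻¹ • A i, hχ,
    fun i => (div_pos (hre i) hsum).le, ?_, fun i => ⟨?_, ?_⟩, ?_⟩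
  · rw [← Finset.sum_div, div_self hsum.ne']
  · exact (hA i).posSemidef.smul (inv_nonneg.mpr (hpos i).le)
  · rw [trace_smul, smul_eq_mul, inv_mul_cancel₀ (hpos i).ne']
  · rw [Finset.smul_sum]
    refine Finset.sum_congr rfl fun i _ => ?_
    rw [smul_kronecker, smul_smul]
    push_cast
    simp only [hcoe]
    congr 1
    rw [div_mul_eq_mul_div, mul_inv_cancel₀ (hpos i).ne', one_div]

theorem commute_smul_smul_one_add_iff {R : Type*} [Ring R] [Algebra ℂ R] {t : ℂ} (ht : t ≠ 0)
    (x y : ℂ) (a b : R) :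
    Commute (t • (x • 1 + a)) (t • (y • 1 + b)) ↔ Commute a b := by
  rw [Commute.smul_left_iff₀ ht, Commute.smul_right_iff₀ ht]
  simp only [← Algebra.algebraMap_eq_smul_one, commute_iff_eq, mul_add, add_mul,
    Algebra.commutes, ← map_mul]
  rw [mul_comm y x]
  constructor
  · intro h
    have := sub_eq_zero.mpr h
    rw [← sub_eq_zero, ← this]
    abel
  · intro h
    rw [h]
    abel

theorem not_isCQ_smul_smul_one_add {d : ℕ} {Z : Matrix (Fin d × Fin d) (Fin d × Fin d) ℂ}
    {F G : Matrix (Fin d) (Fin d) ℂ}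
    (h : ¬ Commute (partialContraction F Z) (partialContraction G Z))
    {t : ℂ} (ht : t ≠ 0) (r : ℂ) : ¬ IsCQ (t • (r • 1 + Z)) := fun hCQ => h <| by
  have := hCQ.commute_partialContraction F G
  rwa [map_smul, map_smul, map_add, map_add, map_smul, map_smul, partialContraction_one,
    partialContraction_one, smul_smul, smul_smul, commute_smul_smul_one_add_iff ht] at this

theorem not_isQC_smul_smul_one_add {d : ℕ} {Z : Matrix (Fin d × Fin d) (Fin d × Fin d) ℂ}
    {F G : Matrix (Fin d) (Fin d) ℂ}
    (h : ¬ Commute (partialContraction F (swapFactors Z)) (partialContraction G (swapFactors Z)))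
    {t : ℂ} (ht : t ≠ 0) (r : ℂ) : ¬ IsQC (t • (r • 1 + Z)) := fun hQC =>
  not_isCQ_smul_smul_one_add h ht r <| by
    simpa only [map_smul, map_add, swapFactors_one] using hQC.swapFactors

/-- Shifting `P ⊗ B + Q ⊗ 1` and its perturbation by `X` far enough into the cone and normalizing
turns them into a quantum-classical state and a state. -/
theorem exists_isQC_isState_sub_eq_smul {d : ℕ} [NeZero d]
    {X : Matrix (Fin d × Fin d) (Fin d × Fin d) ℂ} (hX : X.IsHermitian) (hX0 : X.trace = 0)
    {P Q B : Matrix (Fin d) (Fin d) ℂ} (hP : P.IsHermitian) (hQ : Q.IsHermitian)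
    (hB : B.IsHermitian) :
    ∃ t r : ℂ, t ≠ 0 ∧ IsQC (t • (r • 1 + (P ⊗ₖ B + Q ⊗ₖ 1))) ∧
      IsState (t • (r • 1 + (X + (P ⊗ₖ B + Q ⊗ₖ 1)))) := by
  obtain ⟨χ, b, hχ, h1, hb⟩ := hB.exists_spectral_decomposition
  have hA : ∀ i, ((b i : ℂ) • P + Q).IsHermitian := fun i =>
    IsHermitian.add (IsSelfAdjoint.smul (Complex.conj_ofReal _) hP) hQ
  have hZ : (X + (P ⊗ₖ B + Q ⊗ₖ 1)).IsHermitian := by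
    refine hX.add (IsHermitian.add ?_ ?_)
    · rw [IsHermitian, conjTranspose_kronecker, hP.eq, hB.eq]
    · rw [IsHermitian, conjTranspose_kronecker, hQ.eq, conjTranspose_one]
  choose r₁ hr₁ using fun i => (hA i).exists_posDef_smul_one_add
  obtain ⟨r₂, hr₂⟩ := hZ.exists_posDef_smul_one_add
  obtain ⟨r₃, hr₃⟩ := (Set.finite_range r₁).bddAbove
  obtain ⟨r, hr₃r, hr₂r⟩ : ∃ r, r₃ ≤ r ∧ r₂ ≤ r := ⟨max r₃ r₂, le_max_left _ _, le_max_right _ _⟩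
  have hApos := fun i => hr₁ i r ((hr₃ ⟨i, rfl⟩).trans hr₃r)
  have hZpos := hr₂ r hr₂r
  have hsum : ∑ i, ((r : ℂ) • (1 : Matrix (Fin d) (Fin d) ℂ) + ((b i : ℂ) • P + Q)) ⊗ₖ
      vecMulVec (χ i) (star (χ i)) = (r : ℂ) • 1 + (P ⊗ₖ B + Q ⊗ₖ 1) := by
    have hsplit : ∀ A : Matrix (Fin d) (Fin d) ℂ, ∀ c : Fin d → ℂ,
        ∑ i, c i • (A ⊗ₖ vecMulVec (χ i) (star (χ i)))
          = A ⊗ₖ ∑ i, c i • vecMulVec (χ i) (star (χ i)) := fun A c => by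
      ext p q
      simp [Matrix.sum_apply, Finset.mul_sum, mul_left_comm]
    have h1' := fun A => hsplit A fun _ => 1
    simp only [one_smul, h1] at h1'
    simp only [add_kronecker, smul_kronecker, Finset.sum_add_distrib, hsplit, hb, h1',
      ← Finset.smul_sum, h1, kronecker_smul, one_kronecker_one]
  have htr : ((r : ℂ) • 1 + (X + (P ⊗ₖ B + Q ⊗ₖ 1))).trace
      = ∑ i, ((r : ℂ) • (1 : Matrix (Fin d) (Fin d) ℂ) + ((b i : ℂ) • P + Q)).trace := by
    rw [← trace_sum_kronecker_projections hχ, hsum, add_left_comm, trace_add X, hX0, zero_add]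
  have hpos := hZpos.trace_pos
  refine ⟨_⁻¹, r, inv_ne_zero hpos.ne', ?_, hZpos.posSemidef.smul (inv_nonneg.mpr hpos.le), ?_⟩
  · rw [htr, ← hsum]
    exact isQC_inv_trace_smul_sum hχ hApos
  · rw [trace_smul, smul_eq_mul, inv_mul_cancel₀ hpos.ne']

theorem exists_isHermitian_not_commute {n : Type*} [Fintype n] [DecidableEq n]
    {M : Matrix n n ℂ} (h : ∀ x : ℂ, M ≠ x • 1) :
    ∃ B : Matrix n n ℂ, B.IsHermitian ∧ ¬ Commute M B := by
  by_contra! H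
  obtain ⟨x, hx⟩ := exists_eq_smul_one_of_commute_isHermitian H
  exact h x hx

theorem exists_isHermitian_trace_eq_zero_not_commute {n : Type*} [Fintype n] [DecidableEq n]
    [Nonempty n] {M : Matrix n n ℂ} (h : ∀ x : ℂ, M ≠ x • 1) :
    ∃ B : Matrix n n ℂ, B.IsHermitian ∧ B.trace = 0 ∧ ¬ Commute M B := by
  obtain ⟨B, hB, hMB⟩ := exists_isHermitian_not_commute h
  have hscalar : IsSelfAdjoint (B.trace / Fintype.card n) := by
    rw [IsSelfAdjoint, star_div₀, ← trace_conjTranspose, hB.eq, star_natCast]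
  refine ⟨B - (B.trace / Fintype.card n) • 1, hB.sub (hscalar.smul isHermitian_one), ?_, ?_⟩
  · simp [trace_sub, trace_smul]
  · intro hc
    refine hMB ?_
    simpa using hc.add_right ((Commute.one_right M).smul_right (B.trace / Fintype.card n))

theorem exists_not_commute_partialContraction {d : ℕ} (hd : 2 ≤ d)
    (X : Matrix (Fin d × Fin d) (Fin d × Fin d) ℂ) (a b : Fin d)
    (hX : ∀ x : ℂ, partialContraction (single b a 1) (swapFactors X) ≠ x • 1) :
    ∃ P Q B F G F' G' : Matrix (Fin d) (Fin d) ℂ,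
      P.IsHermitian ∧ Q.IsHermitian ∧ B.IsHermitian ∧
      ¬ Commute (partialContraction F (X + (P ⊗ₖ B + Q ⊗ₖ 1)))
        (partialContraction G (X + (P ⊗ₖ B + Q ⊗ₖ 1))) ∧
      ¬ Commute (partialContraction F' (swapFactors (X + (P ⊗ₖ B + Q ⊗ₖ 1))))
        (partialContraction G' (swapFactors (X + (P ⊗ₖ B + Q ⊗ₖ 1)))) := by
  have : Nontrivial (Fin d) := Fin.nontrivial_iff_two_le.mpr hd
  obtain ⟨c, hc⟩ := exists_ne a
  obtain ⟨B, hB, hB0, hNB⟩ := exists_isHermitian_trace_eq_zero_not_commute hX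
  obtain ⟨P, hPdef⟩ : ∃ P : Matrix (Fin d) (Fin d) ℂ, P = single c c 1 := ⟨_, rfl⟩
  have hP : P.IsHermitian := by simp [IsHermitian, hPdef]
  obtain ⟨Q, hQ, hPQ⟩ := exists_isHermitian_not_commute (M := P) fun x hx => by
    have h1 := congrFun₂ hx a a
    have h2 := congrFun₂ hx c c
    simp [hPdef, hc] at h1 h2
    simp [← h1] at h2
  have hBB : (B * B).trace ≠ 0 := by
    intro h
    have hB' : B = 0 := by
      rw [← trace_conjTranspose_mul_self_eq_zero_iff, hB.eq, h]
    exact hNB (hB' ▸ Commute.zero_right _)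
  set N := partialContraction (single b a 1) (swapFactors X) with hN
  set Y := partialContraction (single c c 1) (swapFactors X) with hY
  set X₁ := partialContraction 1 X with hX₁
  set X₂ := partialContraction B X with hX₂
  obtain ⟨s, hs₁, hs₂⟩ := exists_add_smul_ne_zero_and (N * Y - Y * N) (Q * X₂ - X₂ * Q)
    (sub_ne_zero.mpr hNB) (smul_ne_zero hBB (sub_ne_zero.mpr fun h => hPQ (Eq.symm h)))
  obtain ⟨u, hu, -⟩ := exists_add_smul_ne_zero_and
    (X₁ * (X₂ + (s * (B * B).trace) • P) - (X₂ + (s * (B * B).trace) • P) * X₁) (0 : ℂ)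
    (smul_ne_zero (Nat.cast_ne_zero.mpr (by lia) : (d : ℂ) ≠ 0) hs₂) one_ne_zero
  refine ⟨(s : ℂ) • P, (u : ℂ) • Q, B, 1, B, single b a 1, single c c 1,
    IsSelfAdjoint.smul (Complex.conj_ofReal _) hP, IsSelfAdjoint.smul (Complex.conj_ofReal _) hQ,
    hB, fun h => hu ?_, fun h => hs₁ ?_⟩
  · simp only [map_add, partialContraction_kronecker, one_mul, mul_one, hB0, zero_smul,
      zero_add, add_zero, trace_one, Fintype.card_fin, ← hX₁, ← hX₂] at h
    have := sub_eq_zero.mpr h.eq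
    rw [← this]
    simp only [smul_smul, mul_add, add_mul, smul_add, smul_sub, smul_mul_assoc, mul_smul_comm]
    module
  · have h1 : (single b a 1 * ((s : ℂ) • P)).trace = 0 := by
      simp [hPdef, hc.symm]
    have h2 : (single c c 1 * ((s : ℂ) • P)).trace = (s : ℂ) := by
      simp [hPdef]
    simp only [map_add, swapFactors_kronecker, partialContraction_kronecker, h1, h2, ← hN, ← hY,
      zero_smul, zero_add] at h
    have := sub_eq_zero.mpr h.eq
    rw [← this]
    simp only [mul_add, add_mul, smul_sub, smul_mul_assoc, mul_smul_comm, mul_one, one_mul]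
    module

theorem exists_isQC_isState_not_isCQ_not_isQC {d : ℕ} (hd : 2 ≤ d)
    {X : Matrix (Fin d × Fin d) (Fin d × Fin d) ℂ} (hX : X.IsHermitian) (hX0 : X.trace = 0)
    {a b : Fin d}
    (hab : ∀ x : ℂ, partialContraction (single b a 1) (swapFactors X) ≠ x • 1) :
    ∃ ρ σ : Matrix (Fin d × Fin d) (Fin d × Fin d) ℂ, ∃ t : ℂ,
      IsQC ρ ∧ IsState σ ∧ ¬ IsCQ σ ∧ ¬ IsQC σ ∧ σ = ρ + t • X := by
  have : NeZero d := ⟨by lia⟩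
  obtain ⟨P, Q, B, F, G, F', G', hP, hQ, hB, h, h'⟩ :=
    exists_not_commute_partialContraction hd X a b hab
  obtain ⟨t, r, ht, hρ, hσ⟩ := exists_isQC_isState_sub_eq_smul hX hX0 hP hQ hB
  refine ⟨_, _, t, hρ, hσ, not_isCQ_smul_smul_one_add h ht r,
    not_isQC_smul_smul_one_add h' ht r, by module⟩

theorem partialContraction_single_apply {m n : Type*} [Fintype n] [DecidableEq n]
    (ρ : Matrix (m × n) (m × n) ℂ) (k l : n) (a b : m) :
    partialContraction (single l k 1) ρ a b = ρ (a, k) (b, l) := by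
  simp [partialContraction, single_apply, ite_and]

/-- An operator all of whose blocks, with respect to either factor, are scalar is itself scalar. -/
theorem exists_partialContraction_ne_smul_one {d : ℕ}
    {X : Matrix (Fin d × Fin d) (Fin d × Fin d) ℂ} (hX : X ≠ 0) (hX0 : X.trace = 0) :
    ∃ a b : Fin d, (∀ x : ℂ, partialContraction (single b a 1) (swapFactors X) ≠ x • 1) ∨
      ∀ x : ℂ, partialContraction (single b a 1) X ≠ x • 1 := by
  by_contra! H
  have h1 : ∀ a b, ∃ x : ℂ, ∀ k l, X (a, k) (b, l) = if k = l then x else 0 := fun a b => by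
    obtain ⟨x, hx⟩ := (H a b).1
    refine ⟨x, fun k l => ?_⟩
    simpa [partialContraction_single_apply, Matrix.one_apply] using congrFun₂ hx k l
  have h2 : ∀ k l, ∃ y : ℂ, ∀ a b, X (a, k) (b, l) = if a = b then y else 0 := fun k l => by
    obtain ⟨x, hx⟩ := (H k l).2
    refine ⟨x, fun a b => ?_⟩
    simpa [partialContraction_single_apply, Matrix.one_apply] using congrFun₂ hx a b
  choose x hx using h1
  choose y hy using h2
  have hscalar : ∀ p q r : Fin d × Fin d, X p q = if p = q then X r r else 0 := by
    rintro ⟨a, k⟩ ⟨b, l⟩ ⟨c, m⟩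
    by_cases hab : a = b
    · subst hab
      by_cases hkl : k = l
      · subst hkl
        rw [if_pos rfl, hy, if_pos rfl, hx, if_pos rfl]
        have := hy k k c c
        rw [if_pos rfl, hx, if_pos rfl] at this
        exact this.symm
      · rw [hx, if_neg hkl, if_neg (by simp [hkl])]
    · rw [hy, if_neg hab, if_neg (by simp [hab])]
  refine hX (Matrix.ext fun p q => ?_)
  have htr : (Fintype.card (Fin d × Fin d) : ℂ) * X p p = 0 := by
    rw [← hX0, Matrix.trace, ← nsmul_eq_mul, ← Finset.card_univ, ← Finset.sum_const]
    exact Finset.sum_congr rfl fun r _ => by simpa using hscalar p p r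
  have hp : X p p = 0 := by
    have : Nonempty (Fin d × Fin d) := ⟨p⟩
    exact (mul_eq_zero.mp htr).resolve_left (Nat.cast_ne_zero.mpr Fintype.card_ne_zero)
  rw [hscalar p q p, hp, ite_self, Matrix.zero_apply]

theorem stmt13 (d n : ℕ) (hd : 2 ≤ d)
    (E : Fin n → Matrix (Fin d × Fin d) (Fin d × Fin d) ℂ)
    (hEpos : ∀ j, (E j).PosSemidef) (hEsum : (∑ j, E j) = 1)
    (hdetect : ∀ ρ σ : Matrix (Fin d × Fin d) (Fin d × Fin d) ℂ,
      (IsCQ ρ ∨ IsQC ρ) → IsState σ → ¬ IsCQ σ → ¬ IsQC σ →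
        ∃ j, (ρ * E j).trace ≠ (σ * E j).trace) :
    ∀ ρ σ : Matrix (Fin d × Fin d) (Fin d × Fin d) ℂ,
      IsState ρ → IsState σ → (∀ j, (ρ * E j).trace = (σ * E j).trace) → ρ = σ := by
  intro ρ σ hρ hσ hE
  by_contra hne
  have hX : (ρ - σ).IsHermitian := hρ.1.isHermitian.sub hσ.1.isHermitian
  have hX0 : (ρ - σ).trace = 0 := by rw [trace_sub, hρ.2, hσ.2, sub_self]
  have hXE : ∀ (α : Matrix (Fin d × Fin d) (Fin d × Fin d) ℂ) (t : ℂ) (j : Fin n),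
      (α * E j).trace = ((α + t • (ρ - σ)) * E j).trace := fun α t j => by
    simp [add_mul, sub_mul, trace_sub, hE j]
  obtain ⟨a, b, hab | hab⟩ := exists_partialContraction_ne_smul_one (sub_ne_zero.mpr hne) hX0
  · obtain ⟨α, β, t, hα, hβ, hCQ, hQC, rfl⟩ :=
      exists_isQC_isState_not_isCQ_not_isQC hd hX hX0 hab
    obtain ⟨j, hj⟩ := hdetect α _ (Or.inr hα) hβ hCQ hQC
    exact hj (hXE α t j)
  · obtain ⟨α, β, t, hα, hβ, hCQ, hQC, rfl⟩ :=
      exists_isQC_isState_not_isCQ_not_isQC hd (X := swapFactors (ρ - σ)) (hX.submatrix _)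
        ((trace_swapFactors _).trans hX0) hab
    obtain ⟨j, hj⟩ := hdetect (swapFactors α) _ (Or.inl hα.swapFactors) hβ.swapFactors
      (fun h => hQC (by simpa using h.swapFactors)) (fun h => hCQ (by simpa using h.swapFactors))
    exact hj (by simpa only [map_add, map_smul, swapFactors_swapFactors] using hXE _ t j)
end
end
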